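/- arXiv:1901.05329 — 2 statements merged into one kernel-verified Lean document; each statement's English description precedes it below -/
import Mathlib

section
/- For a positive integer n, let A(n) denote the number of partitions of n into parts congruent to ±1 or ±2 modulo 7. Let B(n) denote the number of bipartitions (π, λ) of n where π is a partition into distinct even parts with a gap of at least 4 between consecutive parts, λ is a partition into distinct parts, and, writing e_1 < e_2 < ⋯ for the parts of π in ascending order, for each j none of e_j/2, e_j/2 + 1, e_j/2 + 2 is a part of λ. Let C(n) denote the number of bipartitions (π, μ) of n where π is as above, μ is a partition into distinct parts, and for each j none of e_j/2 + j − 1, e_j/2 + j, e_j/2 + j + 1 is a part of μ. Then A(n) = B(n) = C(n). -/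
namespace RogersSelberg

section Recurrences

variable {A : Type*} [CommRing A]

/-- A sequence that is eventually known is determined by a recurrence expressing each term through
the next three. -/
theorem eq_of_backward_recurrence {a b d f g : ℕ → A} {N : ℕ}
    (hf : ∀ m, f m = a m * f (m + 1) + b m * f (m + 2) + d m * f (m + 3))
    (hg : ∀ m, g m = a m * g (m + 1) + b m * g (m + 2) + d m * g (m + 3))
    (h : ∀ m, N ≤ m → f m = g m) (m : ℕ) : f m = g m := by
  suffices H : ∀ k m, N ≤ m + k → f m = g m from H N m (by omega)
  intro k
  induction k using Nat.strong_induction_on with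
  | _ k ih =>
    intro m hm
    rcases Nat.eq_zero_or_pos k with rfl | hk
    · exact h m (by omega)
    · rw [hf, hg, ih (k - 1) (by omega) (m + 1) (by omega),
        ih (k - 1) (by omega) (m + 2) (by omega), ih (k - 1) (by omega) (m + 3) (by omega)]

/-- A doubly indexed array satisfying the recurrence of the `C`-bipartitions satisfies, in its first
index, the recurrence of the `B`-bipartitions. -/
theorem recurrence_of_shifted_recurrence {x : A} {N : ℕ} (hx : x ^ N = 0) {C : ℕ → ℕ → A}
    (hC : ∀ c s, C c s = (1 + x ^ (c + 1 + s)) * C (c + 1) s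
      + x ^ (2 * (c + 1)) * C (c + 2) (s + 1))
    (hC1 : ∀ c s, N ≤ c → C c s = 1) (c : ℕ) :
    C c 0 = (1 + x ^ (c + 1)) * C (c + 1) 0 + x ^ (2 * (c + 1)) * C (c + 2) 0
      + -x ^ (3 * (c + 1) + 2) * C (c + 3) 0 := by
  have key : ∀ k c s, N ≤ c + k → C c s = C c (s + 1) + x ^ (c + 1 + s) * C (c + 1) s := by
    intro k
    induction k with
    | zero =>
      intro c s h
      rw [hC1 c s h, hC1 c _ h, pow_eq_zero_of_le (by omega) hx]
      ring
    | succ k ih =>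
      intro c s h
      have e1 := ih (c + 1) s (by omega)
      have e2 := ih (c + 2) (s + 1) (by omega)
      have h0 := hC c s
      have h1 := hC c (s + 1)
      have h2 := hC (c + 1) s
      simp only [pow_add, pow_mul, pow_one, mul_add, mul_one] at *
      linear_combination h0 - h1 + (1 + x ^ c * x * x ^ s * x) * e1 + (x ^ 2) ^ c * x ^ 2 * e2
        - x ^ c * x * x ^ s * x * h2
  have h := key N (c + 2) 0 (by omega)
  rw [hC c 0]
  linear_combination - x ^ (2 * (c + 1)) * h

end Recurrences

section GaussianBinomial

variable {A : Type*} [CommRing A]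

/-- The Gaussian binomial coefficient `[m choose k]` at `q`. -/
def gaussBinom (q : A) : ℕ → ℕ → A
  | _, 0 => 1
  | 0, _ + 1 => 0
  | m + 1, k + 1 => gaussBinom q m k + q ^ (k + 1) * gaussBinom q m (k + 1)

/-- The `q`-factorial `(1 - q)(1 - q ^ 2) ⋯ (1 - q ^ n)`. -/
def qFac (q : A) (n : ℕ) : A := ∏ j ∈ Finset.range n, (1 - q ^ (j + 1))

variable (q : A)

theorem gaussBinom_zero_right (m : ℕ) : gaussBinom q m 0 = 1 := by
  cases m <;> rfl

theorem gaussBinom_succ_succ (m k : ℕ) :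
    gaussBinom q (m + 1) (k + 1) = gaussBinom q m k + q ^ (k + 1) * gaussBinom q m (k + 1) := rfl

theorem gaussBinom_eq_zero_of_lt {m k : ℕ} (h : m < k) : gaussBinom q m k = 0 := by
  induction m generalizing k with
  | zero => obtain ⟨k, rfl⟩ := Nat.exists_eq_add_one_of_ne_zero h.ne'; rfl
  | succ m ih =>
    obtain ⟨k, rfl⟩ := Nat.exists_eq_add_one_of_ne_zero (by omega : k ≠ 0)
    rw [gaussBinom_succ_succ, ih (by omega), ih (by omega)]
    ring

theorem gaussBinom_succ_succ' (m k : ℕ) :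
    gaussBinom q (m + 1) (k + 1) =
      gaussBinom q m (k + 1) + q ^ (m - k) * gaussBinom q m k := by
  induction m generalizing k with
  | zero =>
    cases k with
    | zero => simp [gaussBinom]
    | succ k => simp [gaussBinom]
  | succ m ih =>
    rcases lt_trichotomy k (m + 1) with hk | rfl | hk
    · cases k with
      | zero =>
        have h1 := gaussBinom_succ_succ q (m + 1) 0
        have h2 := gaussBinom_succ_succ q m 0
        have h3 := ih 0
        simp only [gaussBinom_zero_right, Nat.sub_zero] at *
        linear_combination h1 + q * h3 - h2
      | succ k =>
        obtain ⟨d, rfl⟩ := Nat.exists_eq_add_of_le (show k + 1 ≤ m by omega)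
        have h1 := ih k
        have h2 := ih (k + 1)
        rw [show k + 1 + d - k = d + 1 by omega] at h1
        rw [show k + 1 + d - (k + 1) = d by omega] at h2
        rw [show k + 1 + d + 1 - (k + 1) = d + 1 by omega]
        linear_combination gaussBinom_succ_succ q (k + 1 + d + 1) (k + 1) + h1 + q ^ (k + 2) * h2
          - gaussBinom_succ_succ q (k + 1 + d) (k + 1)
          - q ^ (d + 1) * gaussBinom_succ_succ q (k + 1 + d) k
    · rw [gaussBinom_succ_succ, gaussBinom_eq_zero_of_lt q (show m + 1 < m + 1 + 1 by omega)]
      simp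
    · simp [gaussBinom_eq_zero_of_lt q (show m + 1 < k by omega),
        gaussBinom_eq_zero_of_lt q (show m + 1 < k + 1 by omega),
        gaussBinom_eq_zero_of_lt q (show m + 1 + 1 < k + 1 by omega)]

theorem qFac_succ (n : ℕ) : qFac q (n + 1) = qFac q n * (1 - q ^ (n + 1)) :=
  Finset.prod_range_succ _ _

theorem qFac_zero : qFac q 0 = 1 := Finset.prod_range_zero _

theorem gaussBinom_mul_qFac (m k : ℕ) :
    gaussBinom q (m + k) k * (qFac q k * qFac q m) = qFac q (m + k) := by
  induction m generalizing k with
  | zero =>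
    induction k with
    | zero => simp [gaussBinom, qFac_zero]
    | succ k ih =>
      rw [← add_assoc, gaussBinom_succ_succ, gaussBinom_eq_zero_of_lt q (show 0 + k < k + 1 by omega),
        qFac_succ, qFac_succ, ← ih]
      ring
  | succ m ihm =>
    induction k with
    | zero => simp [gaussBinom, qFac_zero]
    | succ k ih =>
      have h1 := ihm (k + 1)
      have h2 := gaussBinom_succ_succ q (m + (k + 1)) k
      rw [show m + 1 + k = m + (k + 1) by ring] at ih
      rw [show m + 1 + (k + 1) = m + (k + 1) + 1 by ring, h2, qFac_succ q (m + (k + 1))]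
      rw [qFac_succ q k] at *
      rw [qFac_succ q m] at *
      linear_combination (1 - q ^ (k + 1)) * ih + q ^ (k + 1) * (1 - q ^ (m + 1)) * h1

variable {q}

theorem isUnit_qFac {N : ℕ} (hq : q ^ N = 0) (n : ℕ) : IsUnit (qFac q n) :=
  (IsUnit.prod_iff).2 fun j _ => (IsNilpotent.pow_succ j ⟨N, hq⟩).isUnit_one_sub

theorem qFac_add_of_pow_eq_zero {N : ℕ} (hq : q ^ N = 0) {n : ℕ} (hn : N ≤ n) :
    qFac q n = qFac q N := by
  induction n, hn using Nat.le_induction with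
  | base => rfl
  | succ n hn ih => rw [qFac_succ, ih, pow_eq_zero_of_le (by omega) hq]; ring

/-- Far from the borders a Gaussian binomial coefficient is the inverse of the `q`-factorial. -/
theorem gaussBinom_mul_qFac_of_pow_eq_zero {N m k : ℕ} (hq : q ^ N = 0) (hm : N ≤ m) (hk : N ≤ k) :
    gaussBinom q (m + k) k * qFac q N = 1 := by
  have h := gaussBinom_mul_qFac q m k
  rw [qFac_add_of_pow_eq_zero hq hm, qFac_add_of_pow_eq_zero hq hk,
    qFac_add_of_pow_eq_zero hq (hm.trans (Nat.le_add_right m k))] at h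
  refine (isUnit_qFac hq N).mul_right_cancel ?_
  rw [one_mul, mul_assoc, h]

end GaussianBinomial

section AndrewsGordon

variable {A : Type*} [CommRing A]

/-- The shifted `q`-factorial `(1 - q ^ (m + 1)) ⋯ (1 - q ^ (m + n))`. -/
def qRising (q : A) (m n : ℕ) : A := ∏ j ∈ Finset.range n, (1 - q ^ (m + j + 1))

theorem qRising_succ (q : A) (m n : ℕ) :
    qRising q m (n + 1) = qRising q m n * (1 - q ^ (m + n + 1)) :=
  Finset.prod_range_succ _ _

theorem qRising_succ' (q : A) (m n : ℕ) :
    qRising q m (n + 1) = (1 - q ^ (m + 1)) * qRising q (m + 1) n := by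
  rw [qRising, Finset.prod_range_succ', mul_comm]
  refine congrArg₂ _ rfl (Finset.prod_congr rfl fun j _ => ?_)
  rw [show m + (j + 1) + 1 = m + 1 + j + 1 by ring]

theorem qRising_zero_left (q : A) (n : ℕ) : qRising q 0 n = qFac q n := by
  simp [qRising, qFac]

/-- The `n`-th term of the Andrews–Gordon series of modulus `7` at `q ^ m`, without its infinite
product; here `i + i' = 4`. -/
noncomputable def agTerm (q : A) (i i' m n : ℕ) : A :=
  (-1) ^ n * q ^ (3 * m * n + 7 * n.choose 2 + (3 + i') * n) * (1 - q ^ (i * (m + 2 * n + 1))) *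
    (qRising q m n * Ring.inverse (qFac q n))

/-- Truncation to `K` terms of the Andrews–Gordon series. -/
noncomputable def agSum (q : A) (K i i' m : ℕ) : A := ∑ n ∈ Finset.range K, agTerm q i i' m n

theorem agSum_zero (q : A) (K i' m : ℕ) : agSum q K 0 i' m = 0 := by
  simp [agSum, agTerm]

variable {q : A} {N : ℕ}

theorem inverse_qFac_succ (hq : q ^ N = 0) (n : ℕ) :
    (1 - q ^ (n + 1)) * Ring.inverse (qFac q (n + 1)) = Ring.inverse (qFac q n) := by
  refine (isUnit_qFac hq n).mul_left_cancel ?_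
  rw [Ring.mul_inverse_cancel _ (isUnit_qFac hq n), ← mul_assoc, ← qFac_succ,
    Ring.mul_inverse_cancel _ (isUnit_qFac hq _)]

theorem agSum_sub_agSum (hq : q ^ N = 0) {K j i' : ℕ} (hK : N ≤ K) (hi : j + 1 + i' = 4) (m : ℕ) :
    agSum q K (j + 1) i' m - agSum q K j (i' + 1) m =
      q ^ ((m + 1) * j) * (1 - q ^ (m + 1)) * agSum q K i' (j + 1) (m + 1) := by
  set u : ℕ → A := fun n => (-1) ^ n * q ^ (3 * m * n + 7 * n.choose 2 + (3 + i') * n) *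
    (1 - q ^ n) * (qRising q m n * Ring.inverse (qFac q n)) with hu
  have hterm (n : ℕ) : agTerm q (j + 1) i' m n - agTerm q j (i' + 1) m n =
      u n - u (n + 1) +
        q ^ ((m + 1) * j) * (1 - q ^ (m + 1)) * agTerm q i' (j + 1) (m + 1) n := by
    have h1 : (1 - q ^ (m + 1)) * qRising q (m + 1) n = qRising q m n * (1 - q ^ (m + n + 1)) := by
      rw [← qRising_succ', qRising_succ]
    have h2 : u (n + 1) = -((-1) ^ n * q ^ (3 * m * (n + 1) + 7 * (n + 1).choose 2
        + (3 + i') * (n + 1)) * (qRising q m n * (1 - q ^ (m + n + 1))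
          * Ring.inverse (qFac q n))) := by
      rw [hu, ← inverse_qFac_succ hq n, ← qRising_succ]
      ring
    have hch : (n + 1).choose 2 = n + n.choose 2 := by
      rw [Nat.choose_succ_succ' n 1, Nat.choose_one_right]
    have h3 : q ^ ((m + 1) * j) * (1 - q ^ (m + 1)) * agTerm q i' (j + 1) (m + 1) n =
        (-1) ^ n * (q ^ ((m + 1) * j) * q ^ (3 * (m + 1) * n + 7 * n.choose 2 + (3 + (j + 1)) * n)) *
        (1 - q ^ (i' * (m + 1 + 2 * n + 1))) *
        ((qRising q m n * (1 - q ^ (m + n + 1))) * Ring.inverse (qFac q n)) := by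
      rw [← h1, agTerm]
      ring
    rw [h2, h3, hch]
    simp only [hu, agTerm]
    obtain rfl : i' = 3 - j := by omega
    obtain rfl | rfl | rfl | rfl : j = 0 ∨ j = 1 ∨ j = 2 ∨ j = 3 := by omega
    all_goals ring
  have h0 : u 0 = 0 := by simp [hu]
  have hKz : u K = 0 := by
    have : q ^ (3 * m * K + 7 * K.choose 2 + (3 + i') * K) = 0 :=
      pow_eq_zero_of_le (by nlinarith) hq
    simp [hu, this]
  simp only [agSum]
  rw [← Finset.sum_sub_distrib, Finset.sum_congr rfl fun n _ => hterm n, Finset.sum_add_distrib,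
    Finset.sum_range_sub', h0, hKz, Finset.mul_sum]
  ring

theorem agSum_eq_one (hq : q ^ N = 0) {K m : ℕ} (hK : 0 < K) (hm : N ≤ m) :
    agSum q K 3 1 m = 1 := by
  rw [agSum, Finset.sum_eq_single_of_mem 0 (Finset.mem_range.2 hK)]
  · simp [agTerm, qRising, qFac, pow_eq_zero_of_le (show N ≤ 3 * (m + 1) by omega) hq]
  · intro n _ hn
    have : q ^ (3 * m * n + 7 * n.choose 2 + (3 + 1) * n) = 0 := by
      refine pow_eq_zero_of_le ?_ hq
      have := Nat.pos_of_ne_zero hn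
      nlinarith
    simp [agTerm, this]

theorem agSum_recurrence (hq : q ^ N = 0) {K : ℕ} (hK : N ≤ K) (m : ℕ) :
    agSum q K 3 1 m =
      (1 + q ^ (m + 1)) * ((1 - q ^ (m + 1)) * agSum q K 3 1 (m + 1))
      + q ^ (2 * (m + 1)) * ((1 - q ^ (m + 1)) * (1 - q ^ (m + 2)) * agSum q K 3 1 (m + 2))
      - q ^ (3 * (m + 1) + 2) * ((1 - q ^ (m + 1)) * (1 - q ^ (m + 2)) * (1 - q ^ (m + 3))
        * agSum q K 3 1 (m + 3)) := by
  have a0 := agSum_sub_agSum hq hK (show 2 + 1 + 1 = 4 from rfl) m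
  have a1 := agSum_sub_agSum hq hK (show 2 + 1 + 1 = 4 from rfl) (m + 1)
  have b0 := agSum_sub_agSum hq hK (show 1 + 1 + 2 = 4 from rfl) m
  have c0 (m : ℕ) := agSum_sub_agSum hq hK (show 0 + 1 + 3 = 4 from rfl) m
  simp only [agSum_zero, sub_zero, Nat.reduceAdd, mul_zero, pow_zero, one_mul, add_assoc] at *
  have c1 := c0 m
  have c2 := c0 (m + 1)
  have c3 := c0 (m + 2)
  simp only [Nat.reduceAdd, add_assoc] at *
  rw [c2] at a0
  rw [c3] at a1
  rw [c1] at b0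
  linear_combination a0 + b0 - q ^ (m + 1) * (1 - q ^ (m + 1)) * a1

end AndrewsGordon

section TripleProduct

variable {A : Type*} [CommRing A]

/-- The exponent `r (7 r - 1) / 2` of the theta series of modulus `7`. -/
def thetaExp (r : ℤ) : ℕ := (r * (7 * r - 1) / 2).toNat

theorem two_mul_thetaExp (r : ℤ) : 2 * (thetaExp r : ℤ) = r * (7 * r - 1) := by
  have h2 : (2 : ℤ) ∣ r * (7 * r - 1) := by
    rcases Int.even_or_odd' r with ⟨k, rfl | rfl⟩
    · exact ⟨k * (14 * k - 1), by ring⟩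
    · exact ⟨(2 * k + 1) * (7 * k + 3), by ring⟩
  have h0 : 0 ≤ r * (7 * r - 1) := by
    rcases le_or_gt r 0 with h | h <;> nlinarith
  rw [thetaExp, Int.toNat_of_nonneg (by omega), Int.mul_ediv_cancel' h2]

/-- The term `(-1) ^ r q ^ (r (7 r - 1) / 2)` of the theta series of modulus `7`. -/
def theta (q : A) (r : ℤ) : A := ((r.negOnePow : ℤ) : A) * q ^ thetaExp r

variable (q : A)

theorem theta_zero : theta q 0 = 1 := by simp [theta, thetaExp]

theorem theta_mul_pow_up {a d : ℕ} {r : ℤ} (h : r + d = a) :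
    q ^ (7 * a + 3) * theta q r = - ((q ^ 7) ^ d * theta q (r + 1)) := by
  have e : 7 * a + 3 + thetaExp r = 7 * d + thetaExp (r + 1) := by
    have h1 := two_mul_thetaExp r
    have h2 := two_mul_thetaExp (r + 1)
    zify
    nlinarith
  simp only [theta, Int.negOnePow_succ]
  rw [mul_left_comm, ← pow_add, mul_left_comm, ← pow_mul, ← pow_add, e]
  simp

theorem theta_mul_pow_down {b k : ℕ} {r : ℤ} (h : r + b = k) :
    q ^ (7 * b + 4) * theta q r = - ((q ^ 7) ^ k * theta q (r - 1)) := by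
  have e : 7 * b + 4 + thetaExp r = 7 * k + thetaExp (r - 1) := by
    have h1 := two_mul_thetaExp r
    have h2 := two_mul_thetaExp (r - 1)
    zify
    nlinarith
  simp only [theta, Int.negOnePow_sub, Int.negOnePow_one]
  rw [mul_left_comm, ← pow_add, mul_left_comm, ← pow_mul, ← pow_add, e]
  simp

/-- The finite form of Jacobi's triple product, with `a` and `b` factors of the two kinds. -/
theorem finite_triple_product (a b : ℕ) :
    (∏ j ∈ Finset.range a, (1 - q ^ (7 * j + 3))) * ∏ j ∈ Finset.range b, (1 - q ^ (7 * j + 4)) =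
      ∑ k ∈ Finset.range (a + b + 1), gaussBinom (q ^ 7) (a + b) k * theta q (k - b) := by
  induction b with
  | zero =>
    induction a with
    | zero => simp [gaussBinom, theta_zero]
    | succ a ih =>
      simp only [Finset.prod_range_zero, mul_one, add_zero, Nat.cast_zero, sub_zero] at ih ⊢
      rw [Finset.prod_range_succ, ih, Finset.sum_mul, Finset.sum_range_succ' _ (a + 1)]
      simp only [gaussBinom_succ_succ', add_mul, Finset.sum_add_distrib]
      have h1 := Finset.sum_range_succ' (fun k : ℕ => gaussBinom (q ^ 7) a k * theta q k) (a + 1)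
      rw [Finset.sum_range_succ, gaussBinom_eq_zero_of_lt _ (Nat.lt_succ_self a), zero_mul,
        add_zero] at h1
      have h2 : ∀ k ∈ Finset.range (a + 1), gaussBinom (q ^ 7) a k * theta q k *
          (1 - q ^ (7 * a + 3)) = gaussBinom (q ^ 7) a k * theta q k
            + (q ^ 7) ^ (a - k) * gaussBinom (q ^ 7) a k * theta q ((k + 1 : ℕ) : ℤ) := by
        intro k hk
        have hk : k ≤ a := by simpa [Nat.lt_succ_iff] using hk
        have := theta_mul_pow_up q (show (k : ℤ) + (a - k : ℕ) = a by omega)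
        push_cast
        linear_combination - gaussBinom (q ^ 7) a k * this
      rw [Finset.sum_congr rfl h2, Finset.sum_add_distrib, h1]
      simp only [gaussBinom_zero_right]
      ring
  | succ b ih =>
    rw [Finset.prod_range_succ, ← mul_assoc, ih, Finset.sum_mul, ← add_assoc,
      Finset.sum_range_succ' _ (a + b + 1)]
    simp only [gaussBinom_succ_succ, add_mul, Finset.sum_add_distrib]
    have h1 := Finset.sum_range_succ' (fun k : ℕ => (q ^ 7) ^ k * gaussBinom (q ^ 7) (a + b) k *
      theta q (k - (b + 1 : ℕ))) (a + b + 1)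
    rw [Finset.sum_range_succ, gaussBinom_eq_zero_of_lt _ (Nat.lt_succ_self (a + b)), mul_zero,
      zero_mul, add_zero] at h1
    have h2 : ∀ k ∈ Finset.range (a + b + 1), gaussBinom (q ^ 7) (a + b) k * theta q (k - b) *
        (1 - q ^ (7 * b + 4)) = gaussBinom (q ^ 7) (a + b) k * theta q ((k + 1 : ℕ) - (b + 1 : ℕ))
          + (q ^ 7) ^ k * gaussBinom (q ^ 7) (a + b) k * theta q (k - (b + 1 : ℕ)) := by
      intro k _
      have := theta_mul_pow_down q (show (k - b : ℤ) + b = k by omega)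
      rw [show ((k + 1 : ℕ) - (b + 1 : ℕ) : ℤ) = k - b by push_cast; ring,
        show ((k : ℤ) - (b + 1 : ℕ)) = k - b - 1 by push_cast; ring]
      linear_combination - gaussBinom (q ^ 7) (a + b) k * this
    rw [Finset.sum_congr rfl h2, Finset.sum_add_distrib, h1]
    simp only [gaussBinom_zero_right]
    ring

theorem sum_theta_symm (M : ℕ) :
    ∑ k ∈ Finset.range (M + M + 1), theta q (k - M) =
      (∑ n ∈ Finset.range M, (theta q (-n) + theta q (n + 1))) + theta q (-M) := by
  induction M with
  | zero => simp
  | succ M ih =>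
    rw [show M + 1 + (M + 1) + 1 = M + M + 1 + 1 + 1 by ring, Finset.sum_range_succ' _ (M + M + 1 + 1),
      Finset.sum_range_succ _ (M + M + 1), Finset.sum_range_succ _ M]
    have h : ∀ k ∈ Finset.range (M + M + 1),
        theta q ((k + 1 : ℕ) - (M + 1 : ℕ)) = theta q (k - M) := by
      intro k _
      congr 1
      push_cast
      ring
    rw [Finset.sum_congr rfl h, ih]
    rw [show ((M + M + 1 + 1 : ℕ) - (M + 1 : ℕ) : ℤ) = M + 1 by push_cast; ring,
      show ((0 : ℕ) - (M + 1 : ℕ) : ℤ) = -(M + 1 : ℕ) by push_cast; ring]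
    ring

variable {q} {N : ℕ}

theorem theta_eq_zero (hq : q ^ N = 0) {r : ℤ} (hr : N ≤ r.natAbs) : theta q r = 0 := by
  have h := two_mul_thetaExp r
  have : N ≤ thetaExp r := by
    zify at hr ⊢
    rcases abs_cases r with ⟨h', _⟩ | ⟨h', _⟩ <;> rw [h'] at hr <;> nlinarith
  rw [theta, pow_eq_zero_of_le this hq, mul_zero]

theorem agTerm_three_zero (hq : q ^ N = 0) (n : ℕ) :
    agTerm q 3 1 0 n = theta q (-n) + theta q (n + 1) := by
  have hch : 2 * (n.choose 2 : ℤ) = n * (n - 1) := by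
    induction n with
    | zero => simp
    | succ n ih =>
      rw [Nat.choose_succ_succ' n 1, Nat.choose_one_right]
      push_cast
      linarith
  have e1 : 3 * 0 * n + 7 * n.choose 2 + (3 + 1) * n = thetaExp (-n) := by
    have := two_mul_thetaExp (-n)
    zify
    nlinarith
  have e2 : thetaExp (-n) + 3 * (0 + 2 * n + 1) = thetaExp (n + 1) := by
    have h1 := two_mul_thetaExp (-n)
    have h2 := two_mul_thetaExp (n + 1)
    zify
    nlinarith
  rw [agTerm, qRising_zero_left, Ring.mul_inverse_cancel _ (isUnit_qFac hq n), mul_one, e1, mul_sub,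
    mul_assoc _ (q ^ thetaExp (-n)) (q ^ _), ← pow_add, e2]
  have hs : (((n : ℤ).negOnePow : ℤ) : A) = (-1) ^ n := by simp [Int.negOnePow_def]
  simp only [theta, Int.negOnePow_succ, Int.negOnePow_neg, Units.val_neg, Int.cast_neg, hs]
  ring

/-- Jacobi's triple product for the Andrews–Gordon series at `m = 0`. -/
theorem agSum_three_zero (hq : q ^ N = 0) (hN : 0 < N) {M : ℕ} (hM : 2 * N ≤ M) :
    agSum q M 3 1 0 = ∏ j ∈ Finset.range M,
      ((1 - q ^ (7 * j + 3)) * (1 - q ^ (7 * j + 4)) * (1 - q ^ (7 * j + 7))) := by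
  have hq7 : (q ^ 7) ^ N = 0 := by rw [← pow_mul, mul_comm, pow_mul, hq, zero_pow (by norm_num)]
  have hfac : ∏ j ∈ Finset.range M, (1 - q ^ (7 * j + 7)) = qFac (q ^ 7) N := by
    rw [← qFac_add_of_pow_eq_zero hq7 (show N ≤ M by omega), qFac]
    refine Finset.prod_congr rfl fun j _ => ?_
    rw [← pow_mul, mul_add, mul_one]
  rw [Finset.prod_mul_distrib, Finset.prod_mul_distrib, finite_triple_product, hfac, Finset.sum_mul]
  have h : ∀ k ∈ Finset.range (M + M + 1),
      gaussBinom (q ^ 7) (M + M) k * theta q (k - M) * qFac (q ^ 7) N = theta q (k - M) := by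
    intro k hk
    rw [Finset.mem_range] at hk
    rcases lt_or_ge ((k - M : ℤ).natAbs) N with h | h
    · obtain ⟨d, hd⟩ := Nat.exists_eq_add_of_le (show k ≤ M + M by omega)
      rw [mul_right_comm, hd, add_comm k d,
        gaussBinom_mul_qFac_of_pow_eq_zero hq7 (by omega) (by omega), one_mul]
    · rw [theta_eq_zero hq h, mul_zero, zero_mul]
  rw [Finset.sum_congr rfl h, sum_theta_symm, theta_eq_zero hq (r := -M) (by omega), add_zero, agSum]
  exact Finset.sum_congr rfl fun n _ => agTerm_three_zero hq n

end TripleProduct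

section GeneratingFunction

open PowerSeries

variable {α β : Type*}

/-- The generating function of a set whose elements are graded by the weight `w`. -/
noncomputable def gen (w : α → ℕ) (S : Set α) : ℤ⟦X⟧ :=
  PowerSeries.mk fun n => ({a ∈ S | w a = n}.ncard : ℤ)

/-- Every weight is attained finitely often. -/
def FiniteFibers (w : α → ℕ) (S : Set α) : Prop := ∀ n, {a ∈ S | w a = n}.Finite

theorem FiniteFibers.mono {w : α → ℕ} {S T : Set α} (hT : FiniteFibers w T) (h : S ⊆ T) :
    FiniteFibers w S := fun n => (hT n).subset fun _ ha => ⟨h ha.1, ha.2⟩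

theorem coeff_gen (w : α → ℕ) (S : Set α) (n : ℕ) :
    coeff n (gen w S) = ({a ∈ S | w a = n}.ncard : ℤ) := coeff_mk _ _

/-- Split a set into a subset and the image of another set under a map raising weights by `d`. -/
theorem gen_eq_add {w : α → ℕ} {v : β → ℕ} {S T : Set α} {U : Set β} {f : β → α} {d : ℕ}
    (hS : FiniteFibers w S) (hTS : T ⊆ S) (hf : Function.Injective f)
    (hfU : ∀ b ∈ U, f b ∈ S ∧ f b ∉ T) (hsplit : ∀ a ∈ S, a ∉ T → ∃ b ∈ U, f b = a)
    (hw : ∀ b, w (f b) = v b + d) :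
    gen w S = gen w T + X ^ d * gen v U := by
  ext n
  rw [map_add, coeff_X_pow_mul', coeff_gen, coeff_gen]
  have hU : {a ∈ S | w a = n} = {a ∈ T | w a = n} ∪ f '' {b ∈ U | v b + d = n} := by
    ext a
    simp only [Set.mem_union, Set.mem_ofPred_eq, Set.mem_image]
    constructor
    · rintro ⟨ha, hn⟩
      by_cases h : a ∈ T
      · exact Or.inl ⟨h, hn⟩
      · obtain ⟨b, hb, rfl⟩ := hsplit a ha h
        exact Or.inr ⟨b, ⟨hb, hw b ▸ hn⟩, rfl⟩
    · rintro (⟨h, hn⟩ | ⟨b, ⟨hb, hn⟩, rfl⟩)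
      · exact ⟨hTS h, hn⟩
      · exact ⟨(hfU b hb).1, (hw b).trans hn⟩
  have hfin := hS n
  rw [hU] at hfin ⊢
  rw [Set.ncard_union_eq ?_ (hfin.subset Set.subset_union_left)
    (hfin.subset Set.subset_union_right), Set.ncard_image_of_injective _ hf, Nat.cast_add]
  · congr 1
    split_ifs with h
    · rw [coeff_gen]
      have : ∀ b, v b + d = n ↔ v b = n - d := fun b => by omega
      simp only [this]
    · have : {b ∈ U | v b + d = n} = ∅ := by
        ext b
        simp only [Set.mem_ofPred_eq, Set.mem_empty_iff_false, iff_false]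
        omega
      simp [this]
  · rw [Set.disjoint_left]
    rintro _ ⟨h, -⟩ ⟨b, ⟨hb, -⟩, rfl⟩
    exact (hfU b hb).2 h

/-- The ring of integral power series modulo `X ^ N`. -/
abbrev TruncRing (N : ℕ) : Type := ℤ⟦X⟧ ⧸ Ideal.span {(X : ℤ⟦X⟧) ^ N}

/-- Reduction of power series modulo `X ^ N`. -/
noncomputable abbrev toTrunc (N : ℕ) : ℤ⟦X⟧ →+* TruncRing N := Ideal.Quotient.mk _

theorem toTrunc_eq_iff {N : ℕ} {f g : ℤ⟦X⟧} :
    toTrunc N f = toTrunc N g ↔ ∀ n < N, coeff n f = coeff n g := by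
  rw [Ideal.Quotient.eq, Ideal.mem_span_singleton, X_pow_dvd_iff]
  simp [sub_eq_zero]

theorem toTrunc_X_pow (N : ℕ) : toTrunc N X ^ N = 0 := by
  rw [← map_pow, Ideal.Quotient.eq_zero_iff_mem]
  exact Ideal.mem_span_singleton_self _

theorem toTrunc_gen_eq_one {N : ℕ} {w : α → ℕ} {S : Set α} {a₀ : α} (h₀ : a₀ ∈ S) (hw₀ : w a₀ = 0)
    (h : ∀ a ∈ S, w a < N → a = a₀) : toTrunc N (gen w S) = 1 := by
  rw [← map_one (toTrunc N), toTrunc_eq_iff]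
  intro n hn
  rw [coeff_gen, coeff_one]
  split_ifs with h0
  · have : {a ∈ S | w a = n} = {a₀} := by
      ext a
      simp only [Set.mem_ofPred_eq, Set.mem_singleton_iff]
      exact ⟨fun ha => h a ha.1 (ha.2 ▸ hn), fun ha => ha ▸ ⟨h₀, hw₀.trans h0.symm⟩⟩
    simp [this]
  · have : {a ∈ S | w a = n} = ∅ := by
      ext a
      simp only [Set.mem_ofPred_eq, Set.mem_empty_iff_false, iff_false]
      rintro ⟨ha, rfl⟩
      rw [h a ha hn, hw₀] at h0
      exact h0 rfl
    simp [this]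

end GeneratingFunction

section Partitions

open PowerSeries

theorem finite_multiset_sum_le (n : ℕ) :
    {s : Multiset ℕ | (∀ x ∈ s, 0 < x) ∧ s.sum ≤ n}.Finite := by
  refine ((Set.finite_Iic n).biUnion fun k _ =>
    Set.finite_range (Nat.Partition.parts (n := k))).subset ?_
  rintro s ⟨hs, hn⟩
  exact Set.mem_biUnion (Set.mem_Iic.2 hn) ⟨⟨s, fun h => hs _ h, rfl⟩, rfl⟩

theorem eq_zero_of_sum_lt {s : Multiset ℕ} {c : ℕ} (hs : ∀ x ∈ s, c ≤ x) (h : s.sum < c) :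
    s = 0 := by
  refine Multiset.eq_zero_of_forall_notMem fun x hx => ?_
  have := Multiset.single_le_sum (fun _ _ => Nat.zero_le _) x hx
  have := hs x hx
  omega

/-- Partitions with all parts at least `c` and satisfying `p`. -/
def restrictedParts (p : ℕ → Prop) (c : ℕ) : Set (Multiset ℕ) := {s | ∀ x ∈ s, c ≤ x ∧ p x}

theorem finiteFibers_restrictedParts (p : ℕ → Prop) {c : ℕ} (hc : 0 < c) :
    FiniteFibers Multiset.sum (restrictedParts p c) := fun n =>
  (finite_multiset_sum_le n).subset fun _ hs => ⟨fun x hx => hc.trans_le (hs.1 x hx).1, hs.2.le⟩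

variable (p : ℕ → Prop) [DecidablePred p]

theorem gen_restrictedParts {c : ℕ} (hc : 0 < c) :
    (if p c then 1 - X ^ c else 1) * gen Multiset.sum (restrictedParts p c) =
      gen Multiset.sum (restrictedParts p (c + 1)) := by
  split_ifs with h
  · have := gen_eq_add (v := Multiset.sum) (T := restrictedParts p (c + 1))
      (U := restrictedParts p c) (f := (c ::ₘ ·)) (d := c)
      (finiteFibers_restrictedParts p hc) (fun s hs x hx => ⟨by have := (hs x hx).1; omega, (hs x hx).2⟩)
      (fun s t h => (Multiset.cons_inj_right c).1 h) ?_ ?_ ?_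
    · rw [sub_mul, one_mul]
      nth_rw 1 [this]
      ring
    · intro s hs
      refine ⟨fun x hx => ?_, fun h' => ?_⟩
      · rcases Multiset.mem_cons.1 hx with rfl | hx
        exacts [⟨le_rfl, h⟩, hs x hx]
      · have := (h' c (Multiset.mem_cons_self c s)).1
        omega
    · intro s hs hs'
      have hcs : c ∈ s := by
        by_contra hcs
        refine hs' fun x hx => ⟨?_, (hs x hx).2⟩
        have := (hs x hx).1
        have : x ≠ c := fun e => hcs (e ▸ hx)
        omega
      obtain ⟨t, rfl⟩ := Multiset.exists_cons_of_mem hcs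
      exact ⟨t, fun x hx => hs x (Multiset.mem_cons_of_mem hx), rfl⟩
    · intro s
      rw [Multiset.sum_cons, add_comm]
  · rw [one_mul]
    congr 1
    ext s
    refine ⟨fun hs x hx => ⟨?_, (hs x hx).2⟩, fun hs x hx => ⟨?_, (hs x hx).2⟩⟩
    · have := hs x hx
      have : x ≠ c := fun e => h (e ▸ this.2)
      omega
    · have := (hs x hx).1
      omega

theorem prod_mul_gen_restrictedParts (M : ℕ) :
    (∏ j ∈ Finset.range M, if p (j + 1) then 1 - X ^ (j + 1) else 1) *
      gen Multiset.sum (restrictedParts p 1) = gen Multiset.sum (restrictedParts p (M + 1)) := by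
  induction M with
  | zero => simp
  | succ M ih =>
    rw [Finset.prod_range_succ, mul_right_comm, ih, mul_comm, gen_restrictedParts p (Nat.succ_pos M)]

theorem toTrunc_prod_mul_gen {M N : ℕ} (h : N ≤ M) :
    (∏ j ∈ Finset.range M, if p (j + 1) then 1 - toTrunc N X ^ (j + 1) else 1) *
      toTrunc N (gen Multiset.sum (restrictedParts p 1)) = 1 := by
  have h1 := toTrunc_gen_eq_one (N := N) (w := Multiset.sum) (S := restrictedParts p (M + 1))
    (a₀ := 0) (by simp [restrictedParts]) Multiset.sum_zero
    (fun s hs hN => eq_zero_of_sum_lt (fun x hx => (hs x hx).1) (by omega))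
  rw [← prod_mul_gen_restrictedParts p M, map_mul, map_prod] at h1
  refine Eq.trans ?_ h1
  congr 1
  refine Finset.prod_congr rfl fun j _ => ?_
  split_ifs <;> simp

end Partitions

section Bipartitions

open PowerSeries

/-- The weight of a bipartition. -/
def bisum (p : Multiset ℕ × Multiset ℕ) : ℕ := p.1.sum + p.2.sum

/-- Bipartitions `(π, μ)` with `π` into distinct even parts `≥ 2 c` with gaps at least `4` and `μ`
into distinct parts `≥ d`. -/
def gapBipartitions (c d : ℕ) : Set (Multiset ℕ × Multiset ℕ) :=
  {p | (∀ x ∈ p.1, 2 * c ≤ x) ∧ (∀ x ∈ p.2, d ≤ x) ∧ p.1.Nodup ∧ (∀ x ∈ p.1, Even x) ∧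
    (∀ x ∈ p.1, ∀ y ∈ p.1, x < y → x + 4 ≤ y) ∧ p.2.Nodup}

theorem finiteFibers_gapBipartitions {c d : ℕ} (hc : 0 < c) (hd : 0 < d) :
    FiniteFibers bisum (gapBipartitions c d) := fun n =>
  ((finite_multiset_sum_le n).prod (finite_multiset_sum_le n)).subset fun p hp => by
    obtain ⟨⟨h1, h2, -⟩, hn⟩ := hp
    unfold bisum at hn
    exact ⟨⟨fun x hx => by have := h1 x hx; omega, by omega⟩,
      ⟨fun x hx => hd.trans_le (h2 x hx), by omega⟩⟩

theorem eq_zero_of_mem_gapBipartitions {c d N : ℕ} {p : Multiset ℕ × Multiset ℕ}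
    (hp : p ∈ gapBipartitions c d) (hc : N ≤ 2 * c) (hd : N ≤ d) (h : bisum p < N) : p = (0, 0) := by
  unfold bisum at h
  exact Prod.ext (eq_zero_of_sum_lt hp.1 (by omega)) (eq_zero_of_sum_lt hp.2.1 (by omega))

theorem cons_fst_mem_gapBipartitions {c d : ℕ} {p : Multiset ℕ × Multiset ℕ} :
    ((2 * c) ::ₘ p.1, p.2) ∈ gapBipartitions c d ↔ p ∈ gapBipartitions (c + 2) d := by
  simp only [gapBipartitions, Set.mem_ofPred_eq, Multiset.mem_cons, Multiset.nodup_cons,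
    forall_eq_or_imp, le_refl, true_and, even_two, Even.mul_right, lt_irrefl, false_imp_iff]
  constructor
  · rintro ⟨h1, h2, ⟨h3, h4⟩, h5, ⟨h6, h7⟩, h8⟩
    refine ⟨fun x hx => ?_, h2, h4, h5, fun x hx => (h7 x hx).2, h8⟩
    have := h1 x hx
    have := h6 x hx (lt_of_le_of_ne this fun e => h3 (e ▸ hx))
    omega
  · rintro ⟨h1, h2, h4, h5, h7, h8⟩
    refine ⟨fun x hx => ?_, h2, ⟨fun h => ?_, h4⟩, h5, ⟨fun x hx _ => ?_,
      fun x hx => ⟨fun h => ?_, h7 x hx⟩⟩, h8⟩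
    · have := h1 x hx; omega
    · have := h1 _ h; omega
    · have := h1 x hx; omega
    · have := h1 x hx; omega

theorem cons_snd_mem_gapBipartitions {c d : ℕ} {p : Multiset ℕ × Multiset ℕ} :
    (p.1, d ::ₘ p.2) ∈ gapBipartitions c d ↔ p ∈ gapBipartitions c (d + 1) := by
  simp only [gapBipartitions, Set.mem_ofPred_eq, Multiset.mem_cons, Multiset.nodup_cons,
    forall_eq_or_imp, le_refl, true_and]
  constructor
  · rintro ⟨h1, h2, h3, h4, h5, h6, h7⟩
    exact ⟨h1, fun x hx => lt_of_le_of_ne (h2 x hx) fun e => h6 (e ▸ hx), h3, h4, h5, h7⟩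
  · rintro ⟨h1, h2, h3, h4, h5, h7⟩
    exact ⟨h1, fun x hx => Nat.le_of_succ_le (h2 x hx), h3, h4, h5,
      fun h => (Nat.lt_irrefl _ (h2 _ h)).elim, h7⟩

theorem mem_gapBipartitions_succ_fst {c d : ℕ} {p : Multiset ℕ × Multiset ℕ} :
    p ∈ gapBipartitions (c + 1) d ↔ p ∈ gapBipartitions c d ∧ 2 * c ∉ p.1 := by
  simp only [gapBipartitions, Set.mem_ofPred_eq]
  constructor
  · rintro ⟨h1, h⟩
    refine ⟨⟨fun x hx => ?_, h⟩, fun hc => ?_⟩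
    · have := h1 x hx; omega
    · have := h1 _ hc; omega
  · rintro ⟨⟨h1, h2, h3, h4, h5⟩, hc⟩
    refine ⟨fun x hx => ?_, h2, h3, h4, h5⟩
    have := h1 x hx
    have : x ≠ 2 * c := fun e => hc (e ▸ hx)
    obtain ⟨k, rfl⟩ := h4 x hx
    omega

theorem mem_gapBipartitions_succ_snd {c d : ℕ} {p : Multiset ℕ × Multiset ℕ} :
    p ∈ gapBipartitions c (d + 1) ↔ p ∈ gapBipartitions c d ∧ d ∉ p.2 := by
  simp only [gapBipartitions, Set.mem_ofPred_eq]
  constructor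
  · rintro ⟨h1, h2, h⟩
    exact ⟨⟨h1, fun x hx => Nat.le_of_succ_le (h2 x hx), h⟩,
      fun hd => Nat.lt_irrefl _ (h2 _ hd)⟩
  · rintro ⟨⟨h1, h2, h⟩, hd⟩
    exact ⟨h1, fun x hx => lt_of_le_of_ne (h2 x hx) fun e => hd (e ▸ hx), h⟩

/-- Split a set of bipartitions according to whether `2 c` is a part of `π`. -/
theorem gen_split_fst {c : ℕ} {S T U : Set (Multiset ℕ × Multiset ℕ)} (hS : FiniteFibers bisum S)
    (hT : ∀ p, p ∈ T ↔ p ∈ S ∧ 2 * c ∉ p.1)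
    (hU : ∀ p : Multiset ℕ × Multiset ℕ, ((2 * c) ::ₘ p.1, p.2) ∈ S ↔ p ∈ U) :
    gen bisum S = gen bisum T + X ^ (2 * c) * gen bisum U := by
  refine gen_eq_add (f := fun p => ((2 * c) ::ₘ p.1, p.2)) hS (fun p hp => ((hT p).1 hp).1)
    (fun p q h => ?_) (fun p hp => ⟨(hU p).2 hp, fun h => ?_⟩) (fun p hp hpT => ?_) fun p => ?_
  · simpa [Prod.ext_iff] using h
  · exact ((hT _).1 h).2 (Multiset.mem_cons_self _ _)
  · have h : 2 * c ∈ p.1 := by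
      by_contra h
      exact hpT ((hT p).2 ⟨hp, h⟩)
    obtain ⟨t, ht⟩ := Multiset.exists_cons_of_mem h
    have e : ((2 * c) ::ₘ t, p.2) = p := Prod.ext ht.symm rfl
    exact ⟨(t, p.2), (hU _).1 (by rwa [e]), e⟩
  · simp only [bisum, Multiset.sum_cons]
    omega

/-- Split a set of bipartitions according to whether `d` is a part of the second partition. -/
theorem gen_split_snd {d : ℕ} {S T U : Set (Multiset ℕ × Multiset ℕ)} (hS : FiniteFibers bisum S)
    (hT : ∀ p, p ∈ T ↔ p ∈ S ∧ d ∉ p.2)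
    (hU : ∀ p : Multiset ℕ × Multiset ℕ, (p.1, d ::ₘ p.2) ∈ S ↔ p ∈ U) :
    gen bisum S = gen bisum T + X ^ d * gen bisum U := by
  refine gen_eq_add (f := fun p => (p.1, d ::ₘ p.2)) hS (fun p hp => ((hT p).1 hp).1)
    (fun p q h => ?_) (fun p hp => ⟨(hU p).2 hp, fun h => ?_⟩) (fun p hp hpT => ?_) fun p => ?_
  · simpa [Prod.ext_iff] using h
  · exact ((hT _).1 h).2 (Multiset.mem_cons_self _ _)
  · have h : d ∈ p.2 := by
      by_contra h
      exact hpT ((hT p).2 ⟨hp, h⟩)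
    obtain ⟨t, ht⟩ := Multiset.exists_cons_of_mem h
    have e : (p.1, d ::ₘ t) = p := Prod.ext rfl ht.symm
    exact ⟨(p.1, t), (hU _).1 (by rwa [e]), e⟩
  · simp only [bisum, Multiset.sum_cons]
    omega

/-- Bipartitions counted by `B`, with parts bounded below. -/
def gapAvoiding (c d : ℕ) : Set (Multiset ℕ × Multiset ℕ) :=
  {p | p ∈ gapBipartitions c d ∧
    ∀ x ∈ p.1, x / 2 ∉ p.2 ∧ x / 2 + 1 ∉ p.2 ∧ x / 2 + 2 ∉ p.2}

/-- Bipartitions counted by `C`, with parts bounded below and the index of every part of the first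
partition shifted by `s`. -/
def shiftedGapAvoiding (c s d : ℕ) : Set (Multiset ℕ × Multiset ℕ) :=
  {p | p ∈ gapBipartitions c d ∧
    ∀ x ∈ p.1, x / 2 + (p.1.filter (fun y => y ≤ x)).card + s - 1 ∉ p.2 ∧
      x / 2 + (p.1.filter (fun y => y ≤ x)).card + s ∉ p.2 ∧
      x / 2 + (p.1.filter (fun y => y ≤ x)).card + s + 1 ∉ p.2}

theorem finiteFibers_gapAvoiding {c d : ℕ} (hc : 0 < c) (hd : 0 < d) :
    FiniteFibers bisum (gapAvoiding c d) :=
  (finiteFibers_gapBipartitions hc hd).mono fun _ h => h.1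

theorem finiteFibers_shiftedGapAvoiding {c s d : ℕ} (hc : 0 < c) (hd : 0 < d) :
    FiniteFibers bisum (shiftedGapAvoiding c s d) :=
  (finiteFibers_gapBipartitions hc hd).mono fun _ h => h.1

theorem gen_gapAvoiding_self {c : ℕ} (hc : 0 < c) :
    gen bisum (gapAvoiding c c) =
      gen bisum (gapAvoiding c (c + 1)) + X ^ c * gen bisum (gapAvoiding (c + 1) (c + 1)) := by
  refine gen_split_snd (finiteFibers_gapAvoiding hc hc) (fun p => ?_) fun p => ?_
  · rw [gapAvoiding, gapAvoiding, Set.mem_ofPred_eq, Set.mem_ofPred_eq,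
      mem_gapBipartitions_succ_snd]
    tauto
  · rw [gapAvoiding, gapAvoiding, Set.mem_ofPred_eq, Set.mem_ofPred_eq,
      cons_snd_mem_gapBipartitions, mem_gapBipartitions_succ_fst]
    simp only [Multiset.mem_cons, not_or]
    constructor
    · rintro ⟨h, h'⟩
      exact ⟨⟨h, fun hx => (h' _ hx).1.1 (by omega)⟩,
        fun x hx => ⟨(h' x hx).1.2, (h' x hx).2.1.2, (h' x hx).2.2.2⟩⟩
    · rintro ⟨⟨h, hc⟩, h'⟩
      refine ⟨h, fun x hx => ?_⟩
      have h1 := h.1 x hx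
      have h2 : x ≠ 2 * c := fun e => hc (e ▸ hx)
      obtain ⟨k, rfl⟩ := h.2.2.2.1 x hx
      exact ⟨⟨by omega, (h' _ hx).1⟩, ⟨by omega, (h' _ hx).2.1⟩, ⟨by omega, (h' _ hx).2.2⟩⟩

theorem gen_gapAvoiding_succ {c : ℕ} (hc : 0 < c) :
    gen bisum (gapAvoiding c (c + 1)) = gen bisum (gapAvoiding (c + 1) (c + 1))
      + X ^ (2 * c) * gen bisum (gapAvoiding (c + 2) (c + 3)) := by
  refine gen_split_fst (finiteFibers_gapAvoiding hc c.succ_pos) (fun p => ?_) fun p => ?_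
  · rw [gapAvoiding, gapAvoiding, Set.mem_ofPred_eq, Set.mem_ofPred_eq,
      mem_gapBipartitions_succ_fst]
    tauto
  · rw [gapAvoiding, gapAvoiding, Set.mem_ofPred_eq, Set.mem_ofPred_eq,
      cons_fst_mem_gapBipartitions, mem_gapBipartitions_succ_snd (c := c + 2) (d := c + 2),
      mem_gapBipartitions_succ_snd (c := c + 2) (d := c + 1)]
    simp only [Multiset.mem_cons, forall_eq_or_imp, Nat.mul_div_cancel_left c (Nat.succ_pos 1)]
    constructor
    · rintro ⟨h, ⟨-, h1, h2⟩, h'⟩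
      exact ⟨⟨⟨h, h1⟩, h2⟩, h'⟩
    · rintro ⟨⟨⟨h, h1⟩, h2⟩, h'⟩
      exact ⟨h, ⟨fun h0 => by have := h.2.1 c h0; omega, h1, h2⟩, h'⟩

theorem gen_gapAvoiding_recurrence {c : ℕ} (hc : 0 < c) :
    gen bisum (gapAvoiding c c) =
      (1 + X ^ c) * gen bisum (gapAvoiding (c + 1) (c + 1))
      + X ^ (2 * c) * gen bisum (gapAvoiding (c + 2) (c + 2))
      + -X ^ (3 * c + 2) * gen bisum (gapAvoiding (c + 3) (c + 3)) := by
  have h0 := gen_gapAvoiding_self hc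
  have h1 := gen_gapAvoiding_succ hc
  have h2 := gen_gapAvoiding_self (c := c + 2) (by omega)
  linear_combination h0 + h1 - X ^ (2 * c) * h2

theorem gen_shiftedGapAvoiding_self {c : ℕ} (hc : 0 < c) (s : ℕ) :
    gen bisum (shiftedGapAvoiding c s (c + s)) =
      gen bisum (shiftedGapAvoiding (c + 1) s (c + s))
      + X ^ (2 * c) * gen bisum (shiftedGapAvoiding (c + 2) (s + 1) (c + s + 3)) := by
  refine gen_split_fst (finiteFibers_shiftedGapAvoiding hc (by omega)) (fun p => ?_) fun p => ?_
  · rw [shiftedGapAvoiding, shiftedGapAvoiding, Set.mem_ofPred_eq, Set.mem_ofPred_eq,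
      mem_gapBipartitions_succ_fst]
    tauto
  · rw [shiftedGapAvoiding, shiftedGapAvoiding, Set.mem_ofPred_eq, Set.mem_ofPred_eq,
      cons_fst_mem_gapBipartitions, mem_gapBipartitions_succ_snd, mem_gapBipartitions_succ_snd,
      mem_gapBipartitions_succ_snd]
    simp only [Multiset.mem_cons, forall_eq_or_imp, Nat.mul_div_cancel_left c (Nat.succ_pos 1),
      and_assoc]
    refine and_congr_right fun h => ?_
    have hge : ∀ x ∈ p.1, 2 * c ≤ x := fun x hx => by have := h.1 x hx; omega
    have hfirst : (Multiset.filter (fun y => y ≤ 2 * c) ((2 * c) ::ₘ p.1)).card = 1 := by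
      rw [Multiset.filter_cons_of_pos (p := fun y => y ≤ 2 * c) _ le_rfl, Multiset.card_cons,
        Multiset.filter_eq_nil.2]
      · rfl
      · intro x hx
        have := h.1 x hx
        omega
    have hrest : ∀ x ∈ p.1, (Multiset.filter (fun y => y ≤ x) ((2 * c) ::ₘ p.1)).card =
        (Multiset.filter (fun y => y ≤ x) p.1).card + 1 := fun x hx => by
      rw [Multiset.filter_cons_of_pos (p := fun y => y ≤ x) _ (hge x hx), Multiset.card_cons]
    rw [hfirst, show c + 1 + s - 1 = c + s by omega, show c + 1 + s = c + s + 1 by omega]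
    refine and_congr_right fun _ => and_congr_right fun _ => and_congr_right fun _ =>
      forall₂_congr fun x hx => ?_
    rw [hrest x hx, ← add_assoc, add_right_comm _ 1 s]
    rfl

theorem gen_shiftedGapAvoiding_succ (c s : ℕ) (h0 : 0 < c + s) :
    gen bisum (shiftedGapAvoiding (c + 1) s (c + s)) =
      (1 + X ^ (c + s)) * gen bisum (shiftedGapAvoiding (c + 1) s (c + s + 1)) := by
  rw [add_mul, one_mul]
  refine gen_split_snd (finiteFibers_shiftedGapAvoiding c.succ_pos h0) (fun p => ?_) fun p => ?_
  · rw [shiftedGapAvoiding, shiftedGapAvoiding, Set.mem_ofPred_eq, Set.mem_ofPred_eq,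
      mem_gapBipartitions_succ_snd]
    tauto
  · rw [shiftedGapAvoiding, shiftedGapAvoiding, Set.mem_ofPred_eq, Set.mem_ofPred_eq,
      cons_snd_mem_gapBipartitions]
    refine and_congr_right fun h => forall₂_congr fun x hx => ?_
    have h1 := h.1 x hx
    have h2 : 0 < (Multiset.filter (fun y => y ≤ x) p.1).card :=
      Multiset.card_pos_iff_exists_mem.2 ⟨x, Multiset.mem_filter.2 ⟨hx, le_rfl⟩⟩
    simp only [Multiset.mem_cons, not_or]
    refine ⟨fun h => ⟨h.1.2, h.2.1.2, h.2.2.2⟩, fun h => ⟨⟨?_, h.1⟩, ⟨?_, h.2.1⟩, ⟨?_, h.2.2⟩⟩⟩ <;>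
      omega

theorem toTrunc_gen_gapAvoiding_eq_one {N c d : ℕ} (hc : N ≤ 2 * c) (hd : N ≤ d) :
    toTrunc N (gen bisum (gapAvoiding c d)) = 1 :=
  toTrunc_gen_eq_one (a₀ := (0, 0)) (by simp [gapAvoiding, gapBipartitions]) (by simp [bisum])
    fun _ hp h => eq_zero_of_mem_gapBipartitions hp.1 hc hd h

theorem toTrunc_gen_shiftedGapAvoiding_eq_one {N c s d : ℕ} (hc : N ≤ 2 * c) (hd : N ≤ d) :
    toTrunc N (gen bisum (shiftedGapAvoiding c s d)) = 1 :=
  toTrunc_gen_eq_one (a₀ := (0, 0)) (by simp [shiftedGapAvoiding, gapBipartitions])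
    (by simp [bisum]) fun _ hp h => eq_zero_of_mem_gapBipartitions hp.1 hc hd h

theorem toTrunc_gen_gapAvoiding_recurrence (N m : ℕ) :
    toTrunc N (gen bisum (gapAvoiding (m + 1) (m + 1))) =
      (1 + toTrunc N X ^ (m + 1)) * toTrunc N (gen bisum (gapAvoiding (m + 1 + 1) (m + 1 + 1)))
      + toTrunc N X ^ (2 * (m + 1)) * toTrunc N (gen bisum (gapAvoiding (m + 2 + 1) (m + 2 + 1)))
      + -toTrunc N X ^ (3 * (m + 1) + 2)
        * toTrunc N (gen bisum (gapAvoiding (m + 3 + 1) (m + 3 + 1))) := by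
  have := congrArg (toTrunc N) (gen_gapAvoiding_recurrence m.succ_pos)
  simpa only [map_add, map_mul, map_neg, map_one, map_pow, Nat.succ_eq_add_one,
    add_right_comm m _ 1] using this

theorem gen_shiftedGapAvoiding_eq_gen_gapAvoiding :
    gen bisum (shiftedGapAvoiding 1 0 1) = gen bisum (gapAvoiding 1 1) := by
  have key : ∀ N, toTrunc N (gen bisum (shiftedGapAvoiding 1 0 1)) =
      toTrunc N (gen bisum (gapAvoiding 1 1)) := fun N => by
    have hC1 : ∀ c s, N ≤ c →
        toTrunc N (gen bisum (shiftedGapAvoiding (c + 1) s (c + 1 + s))) = 1 := fun c s h =>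
      toTrunc_gen_shiftedGapAvoiding_eq_one (by omega) (by omega)
    have hrec := recurrence_of_shifted_recurrence (toTrunc_X_pow N)
      (C := fun c s => toTrunc N (gen bisum (shiftedGapAvoiding (c + 1) s (c + 1 + s))))
      (fun c s => by
        have h1 := gen_shiftedGapAvoiding_self c.succ_pos s
        rw [gen_shiftedGapAvoiding_succ _ _ (by omega)] at h1
        have h2 := congrArg (toTrunc N) h1
        simp only [map_add, map_mul, map_one, map_pow] at h2
        convert h2 using 6 <;> omega)
      hC1
    exact eq_of_backward_recurrence hrec (toTrunc_gen_gapAvoiding_recurrence N)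
      (fun m hm => (hC1 m 0 hm).trans
        (toTrunc_gen_gapAvoiding_eq_one (by omega) (by omega)).symm) 0
  ext n
  exact toTrunc_eq_iff.1 (key (n + 1)) n n.lt_succ_self

end Bipartitions

section Comparison

open PowerSeries

theorem prod_range_seven_mul {A : Type*} [CommRing A] (x : A) (M : ℕ) :
    ∏ j ∈ Finset.range (7 * M), (1 - x ^ (j + 1)) =
      (∏ j ∈ Finset.range (7 * M), if (j + 1) % 7 = 1 ∨ (j + 1) % 7 = 2 ∨ (j + 1) % 7 = 5 ∨
        (j + 1) % 7 = 6 then 1 - x ^ (j + 1) else 1) *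
      ∏ i ∈ Finset.range M,
        ((1 - x ^ (7 * i + 3)) * (1 - x ^ (7 * i + 4)) * (1 - x ^ (7 * i + 7))) := by
  induction M with
  | zero => simp
  | succ M ih =>
    rw [Finset.prod_range_succ _ M, mul_add, mul_one, Finset.prod_range_add, Finset.prod_range_add,
      ih]
    simp only [Finset.prod_range_succ, Finset.prod_range_zero, add_assoc, Nat.mul_add_mod]
    norm_num
    ring

/-- The partitions into parts congruent to `±1` or `±2` modulo `7` have the same generating function
as the bipartitions counted by `B`. -/
theorem gen_restrictedParts_eq_gen_gapAvoiding :
    gen Multiset.sum (restrictedParts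
      (fun x => x % 7 = 1 ∨ x % 7 = 2 ∨ x % 7 = 5 ∨ x % 7 = 6) 1) =
      gen bisum (gapAvoiding 1 1) := by
  have key : ∀ N, 0 < N → toTrunc N (gen Multiset.sum (restrictedParts
      (fun x => x % 7 = 1 ∨ x % 7 = 2 ∨ x % 7 = 5 ∨ x % 7 = 6) 1)) =
      toTrunc N (gen bisum (gapAvoiding 1 1)) := fun N hN => by
    have hx := toTrunc_X_pow N
    have hunit : ∀ i, IsUnit (1 - toTrunc N X ^ (i + 1)) := fun i =>
      IsNilpotent.isUnit_one_sub (IsNilpotent.pow_succ i ⟨N, hx⟩)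
    have hA := toTrunc_prod_mul_gen (fun x => x % 7 = 1 ∨ x % 7 = 2 ∨ x % 7 = 5 ∨ x % 7 = 6)
      (M := 7 * (2 * N)) (N := N) (by omega)
    have hrec := toTrunc_gen_gapAvoiding_recurrence N
    have hone : ∀ m, N ≤ m → toTrunc N (gen bisum (gapAvoiding (m + 1) (m + 1))) = 1 :=
      fun m hm => toTrunc_gen_gapAvoiding_eq_one (by omega) (by omega)
    have hseven := prod_range_seven_mul (toTrunc N X) (2 * N)
    have hag1 := fun m => agSum_recurrence hx (K := 2 * N) (by omega) m
    have hag2 := fun m hm => agSum_eq_one hx (K := 2 * N) (m := m) (by omega) hm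
    have hag3 := agSum_three_zero hx hN le_rfl
    generalize toTrunc N X = x at *
    set f : ℕ → TruncRing N := fun m => toTrunc N (gen bisum (gapAvoiding (m + 1) (m + 1))) with hf
    have hrec' : ∀ m, f m = (1 + x ^ (m + 1)) * f (m + 1) + x ^ (2 * (m + 1)) * f (m + 2)
      + -x ^ (3 * (m + 1) + 2) * f (m + 3) := hrec
    have hP : ∀ m, ∏ j ∈ Finset.Ico m (7 * (2 * N)), (1 - x ^ (j + 1)) =
        (1 - x ^ (m + 1)) * ∏ j ∈ Finset.Ico (m + 1) (7 * (2 * N)), (1 - x ^ (j + 1)) := fun m => by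
      rcases lt_or_ge m (7 * (2 * N)) with h | h
      · exact Finset.prod_eq_prod_Ico_succ_bot h _
      · rw [Finset.Ico_eq_empty (by omega), Finset.Ico_eq_empty (by omega),
          pow_eq_zero_of_le (by omega) hx]
        simp
    have hP1 : ∀ m, N ≤ m → ∏ j ∈ Finset.Ico m (7 * (2 * N)), (1 - x ^ (j + 1)) = 1 :=
      fun m hm => Finset.prod_eq_one fun j hj => by
        rw [pow_eq_zero_of_le (by have := Finset.mem_Ico.1 hj; omega) hx, sub_zero]
    have h0 := eq_of_backward_recurrence (f := fun m => agSum x (2 * N) 3 1 m)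
      (g := fun m => (∏ j ∈ Finset.Ico m (7 * (2 * N)), (1 - x ^ (j + 1))) * f m)
      (a := fun m => (1 + x ^ (m + 1)) * (1 - x ^ (m + 1)))
      (b := fun m => x ^ (2 * (m + 1)) * ((1 - x ^ (m + 1)) * (1 - x ^ (m + 2))))
      (d := fun m => -x ^ (3 * (m + 1) + 2) *
        ((1 - x ^ (m + 1)) * (1 - x ^ (m + 2)) * (1 - x ^ (m + 3))))
      (N := N) (fun m => by linear_combination hag1 m)
      (fun m => by
        have e0 := hP m
        have e1 := hP (m + 1)
        have e2 := hP (m + 2)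
        simp only [e0, e1, e2, hrec' m]
        ring)
      (fun m hm => by simp only [hag2 m hm, hP1 m hm, hone m hm, hf, mul_one]) 0
    simp only [Nat.Ico_zero_eq_range, hag3, hseven] at h0
    have hR : IsUnit (∏ j ∈ Finset.range (2 * N),
        ((1 - x ^ (7 * j + 3)) * (1 - x ^ (7 * j + 4)) * (1 - x ^ (7 * j + 7)))) :=
      Finset.prod_induction _ IsUnit (fun _ _ => IsUnit.mul) isUnit_one fun j _ =>
        ((hunit (7 * j + 2)).mul (hunit (7 * j + 3))).mul (hunit (7 * j + 6))
    have hQ := IsUnit.of_mul_eq_one _ hA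
    refine hQ.mul_left_cancel (hA.trans (hR.mul_left_cancel ?_))
    rw [mul_one]
    refine h0.trans ?_
    simp only [hf]
    ring
  ext n
  exact toTrunc_eq_iff.1 (key (n + 1) n.succ_pos) n n.lt_succ_self

theorem natCard_partition_eq (p : ℕ → Prop) (n : ℕ) :
    Nat.card {q : Nat.Partition n // ∀ x ∈ q.parts, p x} =
      {s ∈ restrictedParts p 1 | s.sum = n}.ncard := by
  rw [← Nat.card_coe_set_eq]
  exact Nat.card_congr
    { toFun := fun q => ⟨q.1.parts, fun x hx => ⟨q.1.parts_pos hx, q.2 x hx⟩, q.1.parts_sum⟩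
      invFun := fun s => ⟨⟨s.1, fun hx => (s.2.1 _ hx).1, s.2.2⟩, fun x hx => (s.2.1 x hx).2⟩
      left_inv := fun _ => rfl
      right_inv := fun _ => rfl }

theorem mem_gapBipartitions_one_iff {p : Multiset ℕ × Multiset ℕ} {n : ℕ} {Q : Prop} :
    ((∀ x ∈ p.1, 0 < x) ∧ (∀ x ∈ p.2, 0 < x) ∧ p.1.sum + p.2.sum = n ∧
      p.1.Nodup ∧ (∀ x ∈ p.1, Even x) ∧ (∀ x ∈ p.1, ∀ y ∈ p.1, x < y → x + 4 ≤ y) ∧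
      p.2.Nodup ∧ Q) ↔ (p ∈ gapBipartitions 1 1 ∧ Q) ∧ bisum p = n := by
  simp only [gapBipartitions, Set.mem_ofPred_eq, bisum]
  constructor
  · rintro ⟨h1, h2, h3, h4, h5, h6, h7, hQ⟩
    refine ⟨⟨⟨fun x hx => ?_, h2, h4, h5, h6, h7⟩, hQ⟩, h3⟩
    have := h1 x hx
    obtain ⟨k, rfl⟩ := h5 x hx
    omega
  · rintro ⟨⟨⟨h1, h2, h4, h5, h6, h7⟩, hQ⟩, h3⟩
    exact ⟨fun x hx => by have := h1 x hx; omega, h2, h3, h4, h5, h6, h7, hQ⟩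

end Comparison

end RogersSelberg

/-- interpretation of Rogers–Selberg S33: `A(n) = B(n) = C(n)`.
Bipartitions are modelled as pairs of multisets of positive integers whose
total sum is `n`.  For `x` the `j`-th part of the distinct-part partition `π`
listed in ascending order, `j` is realized as the number of parts of `π`
that are `≤ x`. -/
theorem rogers_selberg_S33_interpretation (n : ℕ) (hn : 0 < n) :
    -- A(n): partitions of n into parts ≡ ±1, ±2 (mod 7)
    (Nat.card {p : Nat.Partition n //
        ∀ x ∈ p.parts, x % 7 = 1 ∨ x % 7 = 2 ∨ x % 7 = 5 ∨ x % 7 = 6} =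
      -- B(n)
      Nat.card {pl : Multiset ℕ × Multiset ℕ //
        (∀ x ∈ pl.1, 0 < x) ∧ (∀ x ∈ pl.2, 0 < x) ∧ pl.1.sum + pl.2.sum = n ∧
        pl.1.Nodup ∧ (∀ x ∈ pl.1, Even x) ∧
        (∀ x ∈ pl.1, ∀ y ∈ pl.1, x < y → x + 4 ≤ y) ∧
        pl.2.Nodup ∧
        ∀ x ∈ pl.1,
          x / 2 ∉ pl.2 ∧ x / 2 + 1 ∉ pl.2 ∧ x / 2 + 2 ∉ pl.2}) ∧
    -- B(n) = C(n)
    (Nat.card {pl : Multiset ℕ × Multiset ℕ //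
        (∀ x ∈ pl.1, 0 < x) ∧ (∀ x ∈ pl.2, 0 < x) ∧ pl.1.sum + pl.2.sum = n ∧
        pl.1.Nodup ∧ (∀ x ∈ pl.1, Even x) ∧
        (∀ x ∈ pl.1, ∀ y ∈ pl.1, x < y → x + 4 ≤ y) ∧
        pl.2.Nodup ∧
        ∀ x ∈ pl.1,
          x / 2 ∉ pl.2 ∧ x / 2 + 1 ∉ pl.2 ∧ x / 2 + 2 ∉ pl.2} =
      Nat.card {pl : Multiset ℕ × Multiset ℕ //
        (∀ x ∈ pl.1, 0 < x) ∧ (∀ x ∈ pl.2, 0 < x) ∧ pl.1.sum + pl.2.sum = n ∧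
        pl.1.Nodup ∧ (∀ x ∈ pl.1, Even x) ∧
        (∀ x ∈ pl.1, ∀ y ∈ pl.1, x < y → x + 4 ≤ y) ∧
        pl.2.Nodup ∧
        ∀ x ∈ pl.1,
          x / 2 + (pl.1.filter (fun y => y ≤ x)).card - 1 ∉ pl.2 ∧
          x / 2 + (pl.1.filter (fun y => y ≤ x)).card ∉ pl.2 ∧
          x / 2 + (pl.1.filter (fun y => y ≤ x)).card + 1 ∉ pl.2}) := by
  have hB : ∀ p : Multiset ℕ × Multiset ℕ,
      _ ↔ p ∈ RogersSelberg.gapAvoiding 1 1 ∧ RogersSelberg.bisum p = n :=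
    fun p => RogersSelberg.mem_gapBipartitions_one_iff
  have hC : ∀ p : Multiset ℕ × Multiset ℕ,
      _ ↔ p ∈ RogersSelberg.shiftedGapAvoiding 1 0 1 ∧ RogersSelberg.bisum p = n :=
    fun p => RogersSelberg.mem_gapBipartitions_one_iff
  simp only [add_zero] at hC
  rw [RogersSelberg.natCard_partition_eq, Nat.card_congr (Equiv.subtypeEquivRight hB),
    Nat.card_congr (Equiv.subtypeEquivRight hC)]
  have h1 := congrArg (PowerSeries.coeff n) RogersSelberg.gen_restrictedParts_eq_gen_gapAvoiding
  have h2 := congrArg (PowerSeries.coeff n)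
    RogersSelberg.gen_shiftedGapAvoiding_eq_gen_gapAvoiding
  rw [RogersSelberg.coeff_gen, RogersSelberg.coeff_gen, Nat.cast_inj] at h1 h2
  exact ⟨h1, h2.symm⟩
end

section
/- For a positive integer n, let A(n) denote the number of partitions of n into parts congruent to ±2 or ±3 modulo 7. Let B(n) denote the number of bipartitions (π, λ) of n where π is a partition into distinct even parts greater than 2 with a gap of at least 4 between consecutive parts, λ is a partition into distinct parts greater than 1, and, writing e_1 < e_2 < ⋯ for the parts of π in ascending order, for each j none of e_j/2, e_j/2 + 1, e_j/2 + 2 is a part of λ. Let C(n) denote the number of bipartitions (π, μ) of n where π is as above, μ is a partition into distinct parts greater than 1, and for each j none of e_j/2 + j − 1, e_j/2 + j, e_j/2 + j + 1 is a part of μ. Then A(n) = B(n) = C(n). -/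
namespace RogersSelberg

open Finset

section Nilpotent

variable {R : Type*} [CommRing R] {q : R} {K : ℕ}

theorem shifted_eq_add (hq : q ^ K = 0) {c : ℕ → ℕ → R}
    (hc : ∀ d w, c d w = (1 + q ^ (w + d)) * c d (w + 1) + q ^ (2 * w) * c (d + 1) (w + 2))
    (hc1 : ∀ d w, K ≤ w → c d w = 1) (d w : ℕ) :
    c d w = c (d + 1) w + q ^ (w + d) * c d (w + 1) := by
  suffices ∀ k d w, K ≤ w + k → c d w = c (d + 1) w + q ^ (w + d) * c d (w + 1) from
    this K d w (by omega)
  intro k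
  induction k with
  | zero =>
    intro d w h
    rw [add_zero] at h
    rw [hc1 _ _ h, hc1 _ _ h, pow_eq_zero_of_le (by omega : K ≤ w + d) hq]
    ring
  | succ k ih =>
    intro d w h
    have h1 := ih d (w + 1) (by omega)
    have h2 := ih (d + 1) (w + 2) (by omega)
    have h3 := hc d w
    have h4 := hc (d + 1) w
    have h5 := hc d (w + 1)
    rw [h3, h4]
    linear_combination (1 + q ^ (w + 1 + d)) * h1 + q ^ (2 * w) * h2 - q ^ (w + 1 + d) * h5

theorem fixed_eq_shifted (hq : q ^ K = 0) {c : ℕ → ℕ → R} {b d : ℕ → R}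
    (hc : ∀ d w, c d w = (1 + q ^ (w + d)) * c d (w + 1) + q ^ (2 * w) * c (d + 1) (w + 2))
    (hc1 : ∀ d w, K ≤ w → c d w = 1)
    (hb : ∀ m, b m = (1 + q ^ m) * b (m + 1) + q ^ (2 * m) * d (m + 2))
    (hd : ∀ m, d m = b (m + 1) + q ^ (2 * m) * d (m + 2))
    (hb1 : ∀ m, K ≤ m → b m = 1) (hd1 : ∀ m, K ≤ m → d m = 1) (m : ℕ) :
    b m = c 0 m := by
  suffices ∀ k m, K ≤ m + k → b m = c 0 m ∧ d m = c 1 m from (this K m (by omega)).1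
  intro k
  induction k with
  | zero =>
    intro m h
    rw [add_zero] at h
    rw [hb1 m h, hd1 m h, hc1 _ m h, hc1 _ m h]
    exact ⟨rfl, rfl⟩
  | succ k ih =>
    intro m h
    rw [hb m, hd m, (ih (m + 1) (by omega)).1, (ih (m + 2) (by omega)).2]
    refine ⟨(hc 0 m).symm, ?_⟩
    linear_combination shifted_eq_add hq hc hc1 0 m - hc 0 m

/-- The factor `(q;q)_m` shifted to start at `q ^ (n + 1)`. -/
def poch (q : R) (m n : ℕ) : R := ∏ j ∈ range m, (1 - q ^ (n + j + 1))

theorem poch_succ (q : R) (m n : ℕ) : poch q (m + 1) n = poch q m n * (1 - q ^ (n + m + 1)) := by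
  simp [poch, prod_range_succ]

theorem poch_succ' (q : R) (m n : ℕ) :
    poch q (m + 1) n = (1 - q ^ (n + 1)) * poch q m (n + 1) := by
  rw [poch, poch, prod_range_succ', mul_comm]
  simp only [add_zero]
  congr 1
  exact prod_congr rfl fun j _ => by ring_nf

theorem poch_eq_of_le (hq : q ^ K = 0) {m : ℕ} (n : ℕ) (h : K ≤ m) : poch q m n = poch q K n := by
  refine (prod_subset (range_mono h) fun j _ hj => ?_).symm
  rw [pow_eq_zero_of_le (by simp at hj; omega) hq, sub_zero]

/-- Andrews' `J`-series for modulus `7`, multiplied by `(q;q)_∞` and truncated at `K`.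
The relevant values of the parameters are `a = 7 - b`. -/
def gordon (q : R) (K a b m : ℕ) : R :=
  ∑ n ∈ range K, (-1) ^ n * q ^ (7 * n.choose 2 + (3 * m + a) * n) *
    (1 - q ^ (b * (m + 2 * n + 1))) * poch q m n

theorem gordon_sub_gordon (hq : q ^ K = 0) {a b b' : ℕ} (hab : a + b = 6) (hb : b + b' = 3)
    (hb' : 0 < b') (m : ℕ) :
    gordon q K a (b + 1) m - gordon q K (a + 1) b m =
      q ^ (b * (m + 1)) * gordon q K (7 - b') b' (m + 1) := by
  set F : ℕ → R := fun n =>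
    (-1) ^ n * q ^ (7 * n.choose 2 + (3 * m + a) * n) * (1 - q ^ n) * poch q m n with hF
  have key : ∑ n ∈ range K, (F n - F (n + 1)) = 0 := by
    rw [sum_range_sub', hF]
    have : q ^ (7 * K.choose 2 + (3 * m + a) * K) = 0 := by
      refine pow_eq_zero_of_le ?_ hq
      have : 1 * K ≤ (3 * m + a) * K := Nat.mul_le_mul_right _ (by omega)
      omega
    simp [this]
  rw [gordon, gordon, gordon, mul_sum, ← sub_eq_zero, ← sum_sub_distrib, ← sum_sub_distrib, ← key]
  refine sum_congr rfl fun n _ => ?_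
  have h1 := poch_succ q m n
  have h2 := poch_succ' q m n
  have hch : (n + 1).choose 2 = n.choose 2 + n := by
    rw [Nat.choose_succ_succ' n 1]; simp [add_comm]
  simp only [hF, hch]
  rw [h1] at h2 ⊢
  obtain ⟨rfl, rfl, rfl⟩ | ⟨rfl, rfl, rfl⟩ | ⟨rfl, rfl, rfl⟩ :
      b = 0 ∧ a = 6 ∧ b' = 3 ∨ b = 1 ∧ a = 5 ∧ b' = 2 ∨ b = 2 ∧ a = 4 ∧ b' = 1 := by omega
  · linear_combination (-1) ^ n * q ^ (7 * n.choose 2 + (3 * m + 6) * n) *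
      q ^ (3 * m + 6 + 7 * n) * h2
  · linear_combination (-1) ^ n * q ^ (7 * n.choose 2 + (3 * m + 5) * n) *
      q ^ (3 * m + 5 + 7 * n) * h2
  · linear_combination (-1) ^ n * q ^ (7 * n.choose 2 + (3 * m + 4) * n) *
      q ^ (3 * m + 4 + 7 * n) * h2

theorem gordon_of_le (hq : q ^ K = 0) (hK : 0 < K) (a b m : ℕ) (hb : 0 < b) (h : K ≤ m) :
    gordon q K a b m = poch q K 0 := by
  rw [gordon, sum_eq_single_of_mem 0 (by simpa using hK)]
  · rw [pow_eq_zero_of_le (m := K) (n := b * (m + 2 * 0 + 1)) (by nlinarith) hq,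
      poch_eq_of_le hq _ h]
    simp
  · intro n _ hn
    rw [pow_eq_zero_of_le (m := K) (n := 7 * n.choose 2 + (3 * m + a) * n)
      (by nlinarith [Nat.pos_of_ne_zero hn]) hq]
    simp

theorem gordon_eq_mul (hq : q ^ K = 0) (hK : 0 < K) {b d : ℕ → R}
    (hb : ∀ m, b m = (1 + q ^ m) * b (m + 1) + q ^ (2 * m) * d (m + 2))
    (hd : ∀ m, d m = b (m + 1) + q ^ (2 * m) * d (m + 2))
    (hb1 : ∀ m, K ≤ m → b m = 1) :
    gordon q K 6 1 0 = poch q K 0 * b 2 := by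
  have hbd (m) : b m = (1 + q ^ m) * b (m + 1) +
      q ^ (2 * m) * (b (m + 2) - q ^ (m + 2) * b (m + 3)) := by
    linear_combination hb m + q ^ (2 * m) * (hd (m + 2) - hb (m + 2))
  have r1 (m) : gordon q K 6 1 m = gordon q K 4 3 (m + 1) := by
    have := gordon_sub_gordon hq (a := 6) (b := 0) (b' := 3) rfl rfl (by omega) m
    simpa [gordon] using this
  have r2 (m) := gordon_sub_gordon hq (a := 5) (b := 1) (b' := 2) rfl rfl (by omega) m
  have r3 (m) := gordon_sub_gordon hq (a := 4) (b := 2) (b' := 1) rfl rfl (by omega) m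
  norm_num at r2 r3
  suffices ∀ k m, K ≤ m + k → gordon q K 4 3 m = poch q K 0 * b (m + 1) ∧
      gordon q K 5 2 m = poch q K 0 * (b (m + 1) - q ^ (2 * (m + 1)) * b (m + 3)) by
    rw [r1]; exact (this K 1 (by omega)).1
  intro k
  induction k with
  | zero =>
    intro m h
    rw [add_zero] at h
    rw [gordon_of_le hq hK _ _ _ (by omega) h, gordon_of_le hq hK _ _ _ (by omega) h,
      hb1 _ (by omega), pow_eq_zero_of_le (by omega : K ≤ 2 * (m + 1)) hq]
    simp
  | succ k ih =>
    intro m h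
    obtain ⟨i1, i2⟩ := ih (m + 1) (by omega)
    obtain ⟨i3, -⟩ := ih (m + 2) (by omega)
    have e1 := r1 m
    have e1' := r1 (m + 1)
    have e2 := r2 m
    have e3 := r3 m
    have e4 := hbd (m + 1)
    have h2 : gordon q K 5 2 m = poch q K 0 * (b (m + 1) - q ^ (2 * (m + 1)) * b (m + 3)) := by
      linear_combination e2 + e1 + i1 + q ^ (m + 1) * i2 - poch q K 0 * e4
    refine ⟨?_, h2⟩
    linear_combination e3 + h2 + q ^ (2 * (m + 1)) * (e1' + i3)

/-- `(Q^x; Q)_∞` with `Q = q ^ 7`. -/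
def tail (q : R) (K x : ℕ) : R := ∏ j ∈ range K, (1 - q ^ (7 * (x + j)))

theorem tail_eq (hq : q ^ K = 0) (x : ℕ) : tail q K x = (1 - q ^ (7 * x)) * tail q K (x + 1) := by
  have h1 : ∏ j ∈ range (K + 1), (1 - q ^ (7 * (x + j))) = tail q K x := by
    rw [prod_range_succ, pow_eq_zero_of_le (by omega) hq]; simp [tail]
  rw [← h1, prod_range_succ', tail, mul_comm, add_zero]
  congr 1
  exact prod_congr rfl fun j _ => by ring_nf

theorem tail_zero (hK : 0 < K) : tail q K 0 = 0 :=
  prod_eq_zero (i := 0) (by simpa using hK) (by simp)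

theorem tail_of_le (hq : q ^ K = 0) {x : ℕ} (h : K ≤ x) : tail q K x = 1 :=
  prod_eq_one fun j _ => by rw [pow_eq_zero_of_le (by omega) hq, sub_zero]

theorem euler_sum (hq : q ^ K = 0) (hK : 0 < K) :
    ∑ n ∈ range K, (-1) ^ n * q ^ (7 * n.choose 2 + 6 * n) * tail q K (n + 1) =
      tail q K 1 * ∏ j ∈ range K, (1 - q ^ (7 * j + 6)) := by
  set E : ℕ → R := fun s =>
    ∑ n ∈ range K, (-1) ^ n * q ^ (7 * n.choose 2 + (7 * s + 6) * n) * tail q K (n + 1) with hE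
  have step (s) : E s = (1 - q ^ (7 * s + 6)) * E (s + 1) := by
    set F : ℕ → R := fun n =>
      (-1) ^ n * q ^ (7 * n.choose 2 + (7 * s + 6) * n) * tail q K n
    have key : ∑ n ∈ range K, (F n - F (n + 1)) = 0 := by
      rw [sum_range_sub']
      have : q ^ (7 * K.choose 2 + (7 * s + 6) * K) = 0 :=
        pow_eq_zero_of_le (by nlinarith) hq
      simp [F, this, tail_zero hK]
    simp only [hE]
    rw [mul_sum, ← sub_eq_zero, ← sum_sub_distrib, ← key]
    refine sum_congr rfl fun n _ => ?_
    have hch : (n + 1).choose 2 = n.choose 2 + n := by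
      rw [Nat.choose_succ_succ' n 1]; simp [add_comm]
    simp only [F, hch, tail_eq hq n]
    ring
  have iter (s) : E 0 = (∏ j ∈ range s, (1 - q ^ (7 * j + 6))) * E s := by
    induction s with
    | zero => simp
    | succ s ih => rw [ih, step, prod_range_succ]; ring
  have last : E K = tail q K 1 := by
    simp only [hE]
    rw [sum_eq_single_of_mem 0 (by simpa using hK)]
    · simp
    · intro n _ hn
      rw [pow_eq_zero_of_le (m := K) (by nlinarith [Nat.pos_of_ne_zero hn]) hq]
      simp
  have := iter K
  rw [last] at this
  rw [mul_comm, ← this]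

theorem jacobi_sum (hq : q ^ K = 0) (hK : 0 < K) (s : ℕ) :
    ∑ n ∈ range K, (-1) ^ n * q ^ (7 * n.choose 2 + 6 * n) * tail q K (n + s + 1) -
      ∑ n ∈ range s, (-1) ^ n * q ^ (7 * n.choose 2 + 8 * n + 1) * tail q K (s - n) =
      tail q K 1 * (∏ j ∈ range K, (1 - q ^ (7 * j + 6))) *
        ∏ j ∈ range s, (1 - q ^ (7 * j + 1)) := by
  induction s with
  | zero => simpa using euler_sum hq hK
  | succ s ih =>
    rw [prod_range_succ, ← mul_assoc, ← ih]
    have hch (n : ℕ) : (n + 1).choose 2 = n.choose 2 + n := by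
      rw [Nat.choose_succ_succ' n 1]; simp [add_comm]
    set U : ℕ → R := fun n =>
      q ^ (7 * s + 1) * ((-1) ^ n * q ^ (7 * n.choose 2 + 6 * n) * tail q K (n + s + 1)) with hU
    have h1 : ∑ n ∈ range K, (U n - U (n + 1)) = q ^ (7 * s + 1) * tail q K (s + 1) := by
      rw [sum_range_sub']
      have : q ^ (7 * K.choose 2 + 6 * K) = 0 := pow_eq_zero_of_le (by omega) hq
      simp [hU, this]
    have h2 : ∑ n ∈ range K, (-1) ^ n * q ^ (7 * n.choose 2 + 6 * n) * tail q K (n + (s + 1) + 1) -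
        (∑ n ∈ range K, (-1) ^ n * q ^ (7 * n.choose 2 + 6 * n) * tail q K (n + s + 1)) *
          (1 - q ^ (7 * s + 1)) = q ^ (7 * s + 1) * tail q K (s + 1) := by
      rw [← h1, sum_mul, ← sum_sub_distrib]
      refine sum_congr rfl fun n _ => ?_
      simp only [hU, hch]
      rw [tail_eq hq (n + s + 1), show n + 1 + s + 1 = n + (s + 1) + 1 by ring,
        show n + s + 1 + 1 = n + (s + 1) + 1 by ring]
      ring
    set V : ℕ → R := fun n =>
      (-1) ^ n * q ^ (7 * n.choose 2 + 8 * n + 1) * q ^ (7 * (s - n)) * tail q K (s + 1 - n) with hV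
    have hV1 : ∑ n ∈ range (s + 1),
        ((-1) ^ n * q ^ (7 * n.choose 2 + 8 * n + 1) * tail q K (s + 1 - n) - V n) =
        ∑ n ∈ range s, (-1) ^ n * q ^ (7 * n.choose 2 + 8 * n + 1) * tail q K (s - n) := by
      have : ∑ n ∈ range (s + 1), (-1) ^ n * q ^ (7 * n.choose 2 + 8 * n + 1) * tail q K (s - n) =
        ∑ n ∈ range s, (-1) ^ n * q ^ (7 * n.choose 2 + 8 * n + 1) * tail q K (s - n) := by
        rw [sum_range_succ, Nat.sub_self, tail_zero hK]; simp
      rw [← this]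
      refine sum_congr rfl fun n hn => ?_
      have hn : n ≤ s := by simp at hn; omega
      rw [tail_eq hq (s - n), show s - n + 1 = s + 1 - n by omega]
      simp only [hV]
      ring
    have hV2 : ∑ n ∈ range (s + 1), V n = q ^ (7 * s + 1) * tail q K (s + 1) - q ^ (7 * s + 1) *
        ∑ n ∈ range s, (-1) ^ n * q ^ (7 * n.choose 2 + 8 * n + 1) * tail q K (s - n) := by
      rw [sum_range_succ', mul_sum]
      have : ∑ n ∈ range s, V (n + 1) = - ∑ n ∈ range s, q ^ (7 * s + 1) *
          ((-1) ^ n * q ^ (7 * n.choose 2 + 8 * n + 1) * tail q K (s - n)) := by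
        rw [← sum_neg_distrib]
        refine sum_congr rfl fun n hn => ?_
        obtain ⟨t, rfl⟩ : ∃ t, s = n + 1 + t := ⟨s - (n + 1), by simp at hn; omega⟩
        simp only [hV, hch]
        rw [show n + 1 + t - (n + 1) = t by omega, show n + 1 + t + 1 - (n + 1) = t + 1 by omega,
          show n + 1 + t - n = t + 1 by omega]
        ring
      rw [this]
      simp only [hV]
      simp
      ring
    rw [sum_sub_distrib] at hV1
    linear_combination h2 - hV1 - hV2

theorem gordon_eq_prod (hq : q ^ K = 0) (hK : 0 < K) :
    gordon q K 6 1 0 = tail q K 1 * (∏ j ∈ range K, (1 - q ^ (7 * j + 6))) *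
        ∏ j ∈ range K, (1 - q ^ (7 * j + 1)) := by
  have h := jacobi_sum hq hK (2 * K)
  have h1 : ∏ j ∈ range (2 * K), (1 - q ^ (7 * j + 1)) = ∏ j ∈ range K, (1 - q ^ (7 * j + 1)) := by
    refine (prod_subset (range_mono (by omega)) fun j _ hj => ?_).symm
    rw [pow_eq_zero_of_le (by simp at hj; omega) hq, sub_zero]
  have h2 : ∑ n ∈ range (2 * K),
      (-1) ^ n * q ^ (7 * n.choose 2 + 8 * n + 1) * tail q K (2 * K - n) =
      ∑ n ∈ range K, (-1) ^ n * q ^ (7 * n.choose 2 + 8 * n + 1) * tail q K (2 * K - n) := by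
    refine (sum_subset (range_mono (by omega)) fun n _ hn => ?_).symm
    rw [pow_eq_zero_of_le (m := K) (by simp at hn; omega) hq]
    simp
  rw [← h1, ← h, h2, gordon, ← sum_sub_distrib]
  refine sum_congr rfl fun n hn => ?_
  have hn : n < K := by simpa using hn
  rw [tail_of_le hq (by omega), tail_of_le hq (by omega)]
  simp only [poch, range_zero, prod_empty]
  ring

theorem poch_seven_mul (q : R) (M : ℕ) :
    poch q (7 * M) 0 = (∏ j ∈ range M, (1 - q ^ (7 * (1 + j)))) *
      (∏ j ∈ range M, (1 - q ^ (7 * j + 6))) * (∏ j ∈ range M, (1 - q ^ (7 * j + 1))) *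
      ∏ j ∈ range M, ((1 - q ^ (7 * j + 2)) * (1 - q ^ (7 * j + 3)) * (1 - q ^ (7 * j + 4)) *
        (1 - q ^ (7 * j + 5))) := by
  induction M with
  | zero => simp [poch]
  | succ M ih =>
    simp only [show 7 * (M + 1) = 7 * M + 1 + 1 + 1 + 1 + 1 + 1 + 1 by ring, poch_succ, ih,
      prod_range_succ]
    ring_nf

theorem isUnit_poch (hq : q ^ K = 0) (m : ℕ) : IsUnit (poch q m 0) := by
  rw [poch]
  refine IsUnit.prod_iff.2 fun j _ => IsNilpotent.isUnit_one_sub ?_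
  exact IsNilpotent.pow_of_pos ⟨K, hq⟩ (by omega)

theorem partition_eq_fixed (hq : q ^ K = 0) (hK : 0 < K) {a b d : ℕ → R}
    (ha : ∀ m, (m % 7 = 2 ∨ m % 7 = 3 ∨ m % 7 = 4 ∨ m % 7 = 5) → a m = a (m + 1) + q ^ m * a m)
    (ha' : ∀ m, ¬ (m % 7 = 2 ∨ m % 7 = 3 ∨ m % 7 = 4 ∨ m % 7 = 5) → a m = a (m + 1))
    (ha1 : ∀ m, K ≤ m → a m = 1)
    (hb : ∀ m, b m = (1 + q ^ m) * b (m + 1) + q ^ (2 * m) * d (m + 2))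
    (hd : ∀ m, d m = b (m + 1) + q ^ (2 * m) * d (m + 2))
    (hb1 : ∀ m, K ≤ m → b m = 1) :
    a 1 = b 2 := by
  set G := ∏ j ∈ range K, ((1 - q ^ (7 * j + 2)) * (1 - q ^ (7 * j + 3)) * (1 - q ^ (7 * j + 4)) *
        (1 - q ^ (7 * j + 5))) with hG
  have h1 (M) : a 1 * ∏ j ∈ range M, ((1 - q ^ (7 * j + 2)) * (1 - q ^ (7 * j + 3)) *
      (1 - q ^ (7 * j + 4)) * (1 - q ^ (7 * j + 5))) = a (7 * M + 1) := by
    induction M with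
    | zero => simp
    | succ M ih =>
      rw [prod_range_succ, ← mul_assoc, ih]
      have e1 := ha' (7 * M + 1) (by omega)
      have e2 := ha (7 * M + 2) (by omega)
      have e3 := ha (7 * M + 3) (by omega)
      have e4 := ha (7 * M + 4) (by omega)
      have e5 := ha (7 * M + 5) (by omega)
      have e6 := ha' (7 * M + 6) (by omega)
      have e7 := ha' (7 * M + 7) (by omega)
      rw [show 7 * (M + 1) + 1 = 7 * M + 7 + 1 by ring, ← e7, ← e6, e1]
      linear_combination (1 - q ^ (7 * M + 3)) * (1 - q ^ (7 * M + 4)) * (1 - q ^ (7 * M + 5)) * e2 +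
        (1 - q ^ (7 * M + 4)) * (1 - q ^ (7 * M + 5)) * e3 + (1 - q ^ (7 * M + 5)) * e4 + e5
  have h2 : a 1 * G = 1 := by rw [hG, h1, ha1 _ (by omega)]
  have h3 : poch q K 0 = _ * G := (poch_eq_of_le hq 0 (by omega : K ≤ 7 * K)).symm.trans
    (poch_seven_mul q K)
  have h4 := (gordon_eq_prod hq hK).symm.trans (gordon_eq_mul hq hK hb hd hb1)
  rw [tail] at h4
  have h5 : poch q K 0 * (G * b 2) = poch q K 0 * 1 := by
    linear_combination -G * h4 - h3
  have h6 := (isUnit_poch hq K).mul_left_cancel h5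
  linear_combination a 1 * (-h6) + b 2 * h2

end Nilpotent

section GeneratingFunction

variable {α : Type*} {wt : α → ℕ} {s t : Set α}

/-- The generating function of a set `s` with respect to the weight `wt`. -/
noncomputable def genFun (wt : α → ℕ) (s : Set α) : PowerSeries ℤ :=
  PowerSeries.mk fun n => ({x ∈ s | wt x = n}.ncard : ℤ)

theorem genFun_eq_add (h : ∀ n, {x ∈ s | wt x = n}.Finite) (P : α → Prop) :
    genFun wt s = genFun wt {x ∈ s | ¬ P x} + genFun wt {x ∈ s | P x} := by
  ext n
  simp only [genFun, PowerSeries.coeff_mk, map_add]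
  rw [← Nat.cast_add, ← Set.ncard_union_eq ?_ ((h n).subset fun x hx => ⟨hx.1.1, hx.2⟩)
    ((h n).subset fun x hx => ⟨hx.1.1, hx.2⟩)]
  · congr 2
    ext x
    simp only [Set.mem_ofPred_eq, Set.mem_union]
    tauto
  · rw [Set.disjoint_left]
    rintro x ⟨⟨-, h1⟩, -⟩ ⟨⟨-, h2⟩, -⟩
    exact h1 h2

theorem genFun_eq_X_pow_mul (k : ℕ) (f g : α → α) (hf : ∀ x ∈ t, f x ∈ s ∧ g (f x) = x)
    (hg : ∀ x ∈ s, g x ∈ t ∧ f (g x) = x) (hwt : ∀ x ∈ t, wt (f x) = wt x + k) :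
    genFun wt s = PowerSeries.X ^ k * genFun wt t := by
  ext n
  rw [PowerSeries.coeff_X_pow_mul']
  simp only [genFun, PowerSeries.coeff_mk]
  split_ifs with hk
  · rw [Nat.cast_inj]
    refine Set.ncard_congr (fun x _ => g x) ?_ ?_ ?_
    · rintro x ⟨hx, rfl⟩
      have := hwt _ (hg x hx).1
      rw [(hg x hx).2] at this
      exact ⟨(hg x hx).1, by omega⟩
    · rintro x y ⟨hx, -⟩ ⟨hy, -⟩ hxy
      rw [← (hg x hx).2, ← (hg y hy).2, hxy]
    · rintro x ⟨hx, hn⟩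
      exact ⟨f x, ⟨(hf x hx).1, by rw [hwt x hx]; omega⟩, (hf x hx).2⟩
  · rw [Nat.cast_eq_zero]
    convert! Set.ncard_empty α
    refine Set.eq_empty_of_forall_notMem ?_
    rintro x ⟨hx, rfl⟩
    have := hwt _ (hg x hx).1
    rw [(hg x hx).2] at this
    omega

/-- The ring `ℤ[q] / (q ^ K)`. -/
abbrev Truncated (K : ℕ) : Type := PowerSeries ℤ ⧸ Ideal.span {(PowerSeries.X ^ K : PowerSeries ℤ)}

/-- Reduction modulo `q ^ K`. -/
noncomputable abbrev truncate (K : ℕ) : PowerSeries ℤ →+* Truncated K := Ideal.Quotient.mk _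

theorem truncate_eq_iff {K : ℕ} {f g : PowerSeries ℤ} :
    truncate K f = truncate K g ↔ ∀ n < K, PowerSeries.coeff n f = PowerSeries.coeff n g := by
  rw [Ideal.Quotient.eq, Ideal.mem_span_singleton, PowerSeries.X_pow_dvd_iff]
  simp [sub_eq_zero]

theorem truncate_X_pow (K : ℕ) : truncate K PowerSeries.X ^ K = 0 := by
  rw [← map_pow, Ideal.Quotient.eq_zero_iff_mem]
  exact Ideal.mem_span_singleton_self _

theorem truncate_genFun_eq_one {K : ℕ} {x₀ : α} (hx₀ : x₀ ∈ s) (hwt : wt x₀ = 0)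
    (h : ∀ x ∈ s, x ≠ x₀ → K ≤ wt x) : truncate K (genFun wt s) = 1 := by
  rw [← map_one (truncate K), truncate_eq_iff]
  intro n hn
  rw [genFun, PowerSeries.coeff_mk, PowerSeries.coeff_one]
  split_ifs with h0
  · subst h0
    rw [Nat.cast_eq_one, Set.ncard_eq_one]
    refine ⟨x₀, Set.eq_singleton_iff_unique_mem.2 ⟨⟨hx₀, hwt⟩, ?_⟩⟩
    rintro x ⟨hx, hx0⟩
    by_contra hne
    have := h x hx hne
    omega
  · rw [Nat.cast_eq_zero]
    convert! Set.ncard_empty α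
    refine Set.eq_empty_of_forall_notMem ?_
    rintro x ⟨hx, rfl⟩
    by_cases hne : x = x₀
    · exact h0 (by rw [hne, hwt])
    · have := h x hx hne
      omega

end GeneratingFunction

section Partitions

/-- Partitions all of whose parts are positive, at least `m` and congruent to `±2`, `±3` mod `7`. -/
def partitionSet (m : ℕ) : Set (Multiset ℕ) :=
  {p | ∀ x ∈ p, 0 < x ∧ m ≤ x ∧ (x % 7 = 2 ∨ x % 7 = 3 ∨ x % 7 = 4 ∨ x % 7 = 5)}

theorem finite_partitionSet (m n : ℕ) : {p ∈ partitionSet m | p.sum = n}.Finite := by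
  refine (Set.finite_range (fun p : n.Partition => p.parts)).subset ?_
  rintro p ⟨hp, hn⟩
  exact ⟨⟨p, fun {x} hx => (hp x hx).1, hn⟩, rfl⟩

theorem genFun_partitionSet {m : ℕ} (hm : m % 7 = 2 ∨ m % 7 = 3 ∨ m % 7 = 4 ∨ m % 7 = 5) :
    genFun Multiset.sum (partitionSet m) = genFun Multiset.sum (partitionSet (m + 1)) +
      PowerSeries.X ^ m * genFun Multiset.sum (partitionSet m) := by
  rw [genFun_eq_add (finite_partitionSet m) (fun p => m ∈ p)]
  congr 1
  · congr 1
    ext p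
    simp only [partitionSet, Set.mem_ofPred_eq]
    constructor
    · rintro ⟨h1, h2⟩ x hx
      obtain ⟨a, b, c⟩ := h1 x hx
      have : x ≠ m := by rintro rfl; exact h2 hx
      exact ⟨a, by omega, c⟩
    · intro h
      refine ⟨fun x hx => ⟨(h x hx).1, by have := (h x hx).2.1; omega, (h x hx).2.2⟩, fun hx => ?_⟩
      have := (h m hx).2.1
      omega
  · rw [← genFun_eq_add (finite_partitionSet m) (fun p => m ∈ p)]
    refine genFun_eq_X_pow_mul m (fun p => m ::ₘ p) (fun p => p.erase m) ?_ ?_ ?_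
    · intro p hp
      refine ⟨⟨fun x hx => ?_, by simp⟩, by simp⟩
      rw [Multiset.mem_cons] at hx
      obtain rfl | hx := hx
      · exact ⟨by omega, le_rfl, hm⟩
      · exact hp x hx
    · rintro p ⟨hp, hpm⟩
      exact ⟨fun x hx => hp x (Multiset.mem_of_mem_erase hx), Multiset.cons_erase hpm⟩
    · intro p _
      simp [add_comm]

theorem partitionSet_succ {m : ℕ} (hm : ¬ (m % 7 = 2 ∨ m % 7 = 3 ∨ m % 7 = 4 ∨ m % 7 = 5)) :
    partitionSet m = partitionSet (m + 1) := by
  ext p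
  refine forall₂_congr fun x _ => ?_
  have : x = m → ¬ (x % 7 = 2 ∨ x % 7 = 3 ∨ x % 7 = 4 ∨ x % 7 = 5) := by rintro rfl; exact hm
  omega

theorem truncate_partitionSet {K m : ℕ} (h : K ≤ m) :
    truncate K (genFun Multiset.sum (partitionSet m)) = 1 := by
  refine truncate_genFun_eq_one (x₀ := 0) (by simp [partitionSet]) rfl fun p hp hne => ?_
  obtain ⟨x, hx⟩ := Multiset.exists_mem_of_ne_zero hne
  exact h.trans ((hp x hx).2.1.trans (Multiset.le_sum_of_mem hx))

theorem card_partition_eq (n : ℕ) : Nat.card {p : Nat.Partition n //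
      ∀ x ∈ p.parts, x % 7 = 2 ∨ x % 7 = 3 ∨ x % 7 = 4 ∨ x % 7 = 5} =
      {p ∈ partitionSet 1 | p.sum = n}.ncard := by
  have : {p ∈ partitionSet 1 | p.sum = n} = Nat.Partition.parts '' {p : n.Partition |
      ∀ x ∈ p.parts, x % 7 = 2 ∨ x % 7 = 3 ∨ x % 7 = 4 ∨ x % 7 = 5} := by
    ext p
    constructor
    · rintro ⟨hp, hs⟩
      exact ⟨⟨p, fun {x} hx => (hp x hx).1, hs⟩, fun x hx => (hp x hx).2.2, rfl⟩
    · rintro ⟨p, hp, rfl⟩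
      exact ⟨fun x hx => ⟨p.parts_pos hx, p.parts_pos hx, hp x hx⟩, p.parts_sum⟩
  rw [this, Set.ncard_image_of_injective _ fun p p' h => Nat.Partition.ext h]
  rfl

end Partitions

section Bipartitions

/-- Pairs of finite sets; the first component records the halves of the even parts. -/
abbrev Pair : Type := Finset ℕ × Finset ℕ

/-- The size of the bipartition encoded by `p`. -/
def weight (p : Pair) : ℕ := 2 * ∑ x ∈ p.1, x + ∑ y ∈ p.2, y

/-- Bipartitions with lower bounds `a`, `b` in which `x ∈ p.1` forbids `x`, `x + 1`, `x + 2`. -/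
def fixedSet (a b : ℕ) : Set Pair :=
  {p | (∀ x ∈ p.1, a ≤ x) ∧ (∀ y ∈ p.2, b ≤ y) ∧ (∀ x ∈ p.1, ∀ y ∈ p.1, x < y → x + 2 ≤ y) ∧
    ∀ x ∈ p.1, x ∉ p.2 ∧ x + 1 ∉ p.2 ∧ x + 2 ∉ p.2}

/-- Bipartitions with lower bounds `a`, `b` in which the forbidden triple of `x ∈ p.1` is shifted
by `d` plus the number of smaller elements of `p.1`. -/
def shiftedSet (a b d : ℕ) : Set Pair :=
  {p | (∀ x ∈ p.1, a ≤ x) ∧ (∀ y ∈ p.2, b ≤ y) ∧ (∀ x ∈ p.1, ∀ y ∈ p.1, x < y → x + 2 ≤ y) ∧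
    ∀ x ∈ p.1, x + d + #{y ∈ p.1 | y < x} ∉ p.2 ∧ x + d + #{y ∈ p.1 | y < x} + 1 ∉ p.2 ∧
      x + d + #{y ∈ p.1 | y < x} + 2 ∉ p.2}

theorem finite_weight (s : Set Pair) (n : ℕ) : {p ∈ s | weight p = n}.Finite := by
  refine (((range (n + 1)).powerset ×ˢ (range (n + 1)).powerset).finite_toSet).subset ?_
  rintro ⟨S, T⟩ ⟨-, h⟩
  simp only [coe_product, Set.mem_prod, mem_coe, mem_powerset, weight] at h ⊢
  constructor
  · intro x hx
    have := single_le_sum (f := fun x : ℕ => x) (fun _ _ => Nat.zero_le _) hx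
    rw [mem_range]
    omega
  · intro x hx
    have := single_le_sum (f := fun x : ℕ => x) (fun _ _ => Nat.zero_le _) hx
    rw [mem_range]
    omega

theorem truncate_weight {K : ℕ} {s : Set Pair} (h0 : (∅, ∅) ∈ s)
    (h1 : ∀ p ∈ s, ∀ x ∈ p.1, K ≤ x) (h2 : ∀ p ∈ s, ∀ x ∈ p.2, K ≤ x) :
    truncate K (genFun weight s) = 1 := by
  refine truncate_genFun_eq_one h0 (by simp [weight]) ?_
  rintro ⟨S, T⟩ hp hne
  rw [weight]
  by_cases hS : S.Nonempty
  · obtain ⟨x, hx⟩ := hS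
    have := single_le_sum (f := fun x : ℕ => x) (fun _ _ => Nat.zero_le _) hx
    have := h1 _ hp x hx
    dsimp only at *
    omega
  · have hT : T.Nonempty := by
      rw [nonempty_iff_ne_empty] at hS ⊢
      rintro rfl
      exact hne (by rw [not_not.1 hS])
    obtain ⟨x, hx⟩ := hT
    have := single_le_sum (f := fun x : ℕ => x) (fun _ _ => Nat.zero_le _) hx
    have := h2 _ hp x hx
    dsimp only at *
    omega

theorem genFun_insert_fst {s t : Set Pair} (k : ℕ)
    (h1 : ∀ p ∈ t, k ∉ p.1 ∧ (insert k p.1, p.2) ∈ s)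
    (h2 : ∀ p ∈ s, k ∈ p.1 ∧ (p.1.erase k, p.2) ∈ t) :
    genFun weight s = PowerSeries.X ^ (2 * k) * genFun weight t := by
  refine genFun_eq_X_pow_mul _ (fun p => (insert k p.1, p.2)) (fun p => (p.1.erase k, p.2))
    (fun p hp => ⟨(h1 p hp).2, ?_⟩) (fun p hp => ⟨(h2 p hp).2, ?_⟩) fun p hp => ?_
  · simp [erase_insert (h1 p hp).1]
  · simp [insert_erase (h2 p hp).1]
  · simp only [weight, sum_insert (h1 p hp).1]
    ring

theorem genFun_insert_snd {s t : Set Pair} (k : ℕ)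
    (h1 : ∀ p ∈ t, k ∉ p.2 ∧ (p.1, insert k p.2) ∈ s)
    (h2 : ∀ p ∈ s, k ∈ p.2 ∧ (p.1, p.2.erase k) ∈ t) :
    genFun weight s = PowerSeries.X ^ k * genFun weight t := by
  refine genFun_eq_X_pow_mul _ (fun p => (p.1, insert k p.2)) (fun p => (p.1, p.2.erase k))
    (fun p hp => ⟨(h1 p hp).2, ?_⟩) (fun p hp => ⟨(h2 p hp).2, ?_⟩) fun p hp => ?_
  · simp [erase_insert (h1 p hp).1]
  · simp [insert_erase (h2 p hp).1]
  · simp only [weight, sum_insert (h1 p hp).1]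
    ring

theorem genFun_fixedSet_fst {m b : ℕ} (hb : b ≤ m + 3) (hb' : m ≤ b) :
    genFun weight {p ∈ fixedSet m b | m ∈ p.1} =
      PowerSeries.X ^ (2 * m) * genFun weight (fixedSet (m + 2) (m + 3)) := by
  refine genFun_insert_fst m ?_ ?_
  · rintro ⟨S, T⟩ ⟨h1, h2, h3, h4⟩
    dsimp only at *
    refine ⟨fun h => by have := h1 m h; omega, ⟨?_, ?_, ?_, ?_⟩, mem_insert_self _ _⟩
    · grind
    · grind
    · grind
    · grind
  · rintro ⟨S, T⟩ ⟨⟨h1, h2, h3, h4⟩, hm⟩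
    dsimp only at *
    refine ⟨hm, ?_, ?_, ?_, ?_⟩
    · grind
    · have := h4 m hm
      intro y hy
      have : y ≠ m ∧ y ≠ m + 1 ∧ y ≠ m + 2 := by
        refine ⟨?_, ?_, ?_⟩ <;> rintro rfl <;> tauto
      have := h2 y hy
      omega
    · grind
    · grind

theorem fixedSet_notMem_fst (m b : ℕ) : {p ∈ fixedSet m b | m ∉ p.1} = fixedSet (m + 1) b := by
  ext ⟨S, T⟩
  constructor
  · rintro ⟨⟨h1, h2, h3, h4⟩, hm⟩
    refine ⟨?_, h2, h3, h4⟩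
    grind
  · rintro ⟨h1, h2, h3, h4⟩
    refine ⟨⟨?_, h2, h3, h4⟩, ?_⟩
    · grind
    · grind

theorem genFun_fixedSet_snd (m : ℕ) : genFun weight (fixedSet (m + 1) m) =
    (1 + PowerSeries.X ^ m) * genFun weight (fixedSet (m + 1) (m + 1)) := by
  rw [genFun_eq_add (finite_weight _) (fun p => m ∈ p.2), add_mul, one_mul]
  congr 1
  · congr 1
    ext ⟨S, T⟩
    constructor
    · rintro ⟨⟨h1, h2, h3, h4⟩, hm⟩
      refine ⟨h1, ?_, h3, h4⟩
      grind
    · rintro ⟨h1, h2, h3, h4⟩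
      refine ⟨⟨h1, ?_, h3, h4⟩, ?_⟩
      · grind
      · grind
  · refine genFun_insert_snd m ?_ ?_
    · rintro ⟨S, T⟩ ⟨h1, h2, h3, h4⟩
      dsimp only at *
      refine ⟨fun h => by have := h2 m h; omega, ⟨h1, ?_, h3, ?_⟩, mem_insert_self _ _⟩
      · grind
      · grind
    · rintro ⟨S, T⟩ ⟨⟨h1, h2, h3, h4⟩, hm⟩
      dsimp only at *
      refine ⟨hm, h1, ?_, h3, ?_⟩
      · grind
      · grind

theorem genFun_fixedSet_succ (m : ℕ) : genFun weight (fixedSet m (m + 1)) =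
    genFun weight (fixedSet (m + 1) (m + 1)) +
      PowerSeries.X ^ (2 * m) * genFun weight (fixedSet (m + 2) (m + 3)) := by
  rw [genFun_eq_add (finite_weight _) (fun p => m ∈ p.1), fixedSet_notMem_fst,
    genFun_fixedSet_fst (by omega) (by omega)]

theorem genFun_fixedSet_self (m : ℕ) : genFun weight (fixedSet m m) =
    (1 + PowerSeries.X ^ m) * genFun weight (fixedSet (m + 1) (m + 1)) +
      PowerSeries.X ^ (2 * m) * genFun weight (fixedSet (m + 2) (m + 3)) := by
  rw [genFun_eq_add (finite_weight _) (fun p => m ∈ p.1), fixedSet_notMem_fst,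
    genFun_fixedSet_fst (by omega) le_rfl, genFun_fixedSet_snd]

theorem card_filter_lt_insert {S : Finset ℕ} {w x : ℕ} (hw : w ∉ S) (hx : w < x) :
    #{y ∈ insert w S | y < x} = #{y ∈ S | y < x} + 1 := by
  rw [filter_insert, if_pos hx, card_insert_of_notMem (by simp [hw])]

theorem card_filter_lt_eq_zero {S : Finset ℕ} {w : ℕ} (h : ∀ x ∈ S, w ≤ x) :
    #{y ∈ S | y < w} = 0 := by
  rw [card_eq_zero, filter_eq_empty_iff]
  exact fun x hx => not_lt.2 (h x hx)

theorem genFun_shiftedSet_fst (d w : ℕ) :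
    genFun weight {p ∈ shiftedSet w (w + d) d | w ∈ p.1} = PowerSeries.X ^ (2 * w) *
      genFun weight (shiftedSet (w + 2) (w + 2 + (d + 1)) (d + 1)) := by
  refine genFun_insert_fst w ?_ ?_
  · rintro ⟨S, T⟩ ⟨h1, h2, h3, h4⟩
    dsimp only at *
    have hw : w ∉ S := fun h => by have := h1 w h; omega
    have hins : ∀ x ∈ insert w S, w ≤ x := by grind
    refine ⟨hw, ⟨hins, ?_, ?_, ?_⟩, mem_insert_self _ _⟩
    · grind
    · grind
    · intro x hx
      dsimp only at *
      obtain rfl | hx := mem_insert.1 hx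
      · rw [card_filter_lt_eq_zero hins]
        refine ⟨fun h => ?_, fun h => ?_, fun h => ?_⟩ <;> have := h2 _ h <;> omega
      · rw [card_filter_lt_insert hw (by have := h1 x hx; omega)]
        rw [show x + d + (#{y ∈ S | y < x} + 1) = x + (d + 1) + #{y ∈ S | y < x} by ring]
        exact h4 x hx
  · rintro ⟨S, T⟩ ⟨⟨h1, h2, h3, h4⟩, hm⟩
    dsimp only at *
    have h5 : ∀ x ∈ S.erase w, w + 2 ≤ x := by grind
    refine ⟨hm, h5, ?_, ?_, ?_⟩
    · have := h4 w hm
      rw [card_filter_lt_eq_zero h1] at this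
      intro y hy
      have : y ≠ w + d ∧ y ≠ w + d + 1 ∧ y ≠ w + d + 2 := by
        refine ⟨?_, ?_, ?_⟩ <;> rintro rfl <;> tauto
      have := h2 y hy
      omega
    · grind
    · intro x hx
      dsimp only at *
      have h6 := card_filter_lt_insert (notMem_erase w S) (x := x) (by have := h5 x hx; omega)
      rw [insert_erase hm] at h6
      have h7 := h4 x (mem_of_mem_erase hx)
      rw [h6] at h7
      rw [show x + (d + 1) + #{y ∈ S.erase w | y < x} =
        x + d + (#{y ∈ S.erase w | y < x} + 1) by ring]
      exact h7

theorem shiftedSet_notMem_fst (w b d : ℕ) :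
    {p ∈ shiftedSet w b d | w ∉ p.1} = shiftedSet (w + 1) b d := by
  ext ⟨S, T⟩
  constructor
  · rintro ⟨⟨h1, h2, h3, h4⟩, hm⟩
    refine ⟨?_, h2, h3, h4⟩
    grind
  · rintro ⟨h1, h2, h3, h4⟩
    refine ⟨⟨?_, h2, h3, h4⟩, ?_⟩
    · grind
    · grind

theorem genFun_shiftedSet_snd (d w : ℕ) : genFun weight (shiftedSet (w + 1) (w + d) d) =
    (1 + PowerSeries.X ^ (w + d)) * genFun weight (shiftedSet (w + 1) (w + 1 + d) d) := by
  rw [genFun_eq_add (finite_weight _) (fun p => w + d ∈ p.2), add_mul, one_mul]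
  congr 1
  · congr 1
    ext ⟨S, T⟩
    constructor
    · rintro ⟨⟨h1, h2, h3, h4⟩, hm⟩
      refine ⟨h1, ?_, h3, h4⟩
      grind
    · rintro ⟨h1, h2, h3, h4⟩
      refine ⟨⟨h1, ?_, h3, h4⟩, ?_⟩
      · grind
      · grind
  · refine genFun_insert_snd (w + d) ?_ ?_
    · rintro ⟨S, T⟩ ⟨h1, h2, h3, h4⟩
      dsimp only at *
      refine ⟨fun h => by have := h2 _ h; omega, ⟨h1, ?_, h3, ?_⟩, mem_insert_self _ _⟩
      · grind
      · grind
    · rintro ⟨S, T⟩ ⟨⟨h1, h2, h3, h4⟩, hm⟩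
      dsimp only at *
      refine ⟨hm, h1, ?_, h3, ?_⟩
      · grind
      · grind

theorem genFun_shiftedSet (d w : ℕ) : genFun weight (shiftedSet w (w + d) d) =
    (1 + PowerSeries.X ^ (w + d)) * genFun weight (shiftedSet (w + 1) (w + 1 + d) d) +
      PowerSeries.X ^ (2 * w) *
        genFun weight (shiftedSet (w + 2) (w + 2 + (d + 1)) (d + 1)) := by
  rw [genFun_eq_add (finite_weight _) (fun p => w ∈ p.1), shiftedSet_notMem_fst,
    genFun_shiftedSet_fst, genFun_shiftedSet_snd]

theorem ncard_eq (n : ℕ) :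
    {p ∈ partitionSet 1 | p.sum = n}.ncard = {p ∈ fixedSet 2 2 | weight p = n}.ncard ∧
    {p ∈ fixedSet 2 2 | weight p = n}.ncard = {p ∈ shiftedSet 2 2 0 | weight p = n}.ncard := by
  set K := n + 1
  have hq := truncate_X_pow K
  have hb (m) := congrArg (truncate K) (genFun_fixedSet_self m)
  have hd (m) := congrArg (truncate K) (genFun_fixedSet_succ m)
  have hc (d w) := congrArg (truncate K) (genFun_shiftedSet d w)
  have ha (m) (hm : m % 7 = 2 ∨ m % 7 = 3 ∨ m % 7 = 4 ∨ m % 7 = 5) :=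
    congrArg (truncate K) (genFun_partitionSet hm)
  simp only [map_add, map_mul, map_pow, map_one] at hb hd hc ha
  have hb1 (m) (h : K ≤ m) : truncate K (genFun weight (fixedSet m m)) = 1 :=
    truncate_weight (by simp [fixedSet]) (fun p hp x hx => h.trans (hp.1 x hx))
      fun p hp x hx => h.trans (hp.2.1 x hx)
  have hd1 (m) (h : K ≤ m) : truncate K (genFun weight (fixedSet m (m + 1))) = 1 :=
    truncate_weight (by simp [fixedSet]) (fun p hp x hx => h.trans (hp.1 x hx))
      fun p hp x hx => by have := hp.2.1 x hx; omega
  have hc1 (d m) (h : K ≤ m) : truncate K (genFun weight (shiftedSet m (m + d) d)) = 1 :=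
    truncate_weight (by simp [shiftedSet]) (fun p hp x hx => h.trans (hp.1 x hx))
      fun p hp x hx => by have := hp.2.1 x hx; omega
  have ab := partition_eq_fixed (a := fun m => truncate K (genFun Multiset.sum (partitionSet m)))
    (b := fun m => truncate K (genFun weight (fixedSet m m)))
    (d := fun m => truncate K (genFun weight (fixedSet m (m + 1)))) hq (by omega) ha
    (fun m hm => by rw [partitionSet_succ hm]) (fun m => truncate_partitionSet) hb hd hb1
  have bc := fixed_eq_shifted (c := fun d w => truncate K (genFun weight (shiftedSet w (w + d) d)))
    (b := fun m => truncate K (genFun weight (fixedSet m m)))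
    (d := fun m => truncate K (genFun weight (fixedSet m (m + 1)))) hq hc hc1 hb hd hb1 hd1 2
  have ab' := truncate_eq_iff.1 ab n (by omega)
  have bc' := truncate_eq_iff.1 bc n (by omega)
  simp only [genFun, PowerSeries.coeff_mk, Nat.cast_inj] at ab' bc'
  exact ⟨ab', bc'⟩

/-- The pair of multisets of parts encoded by `p`. -/
def toParts (p : Pair) : Multiset ℕ × Multiset ℕ := (p.1.val.map (2 * ·), p.2.val)

theorem toParts_injective : Function.Injective toParts := by
  rintro ⟨S, T⟩ ⟨S', T'⟩ h
  simp only [toParts, Prod.mk.injEq, val_inj] at h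
  obtain ⟨h1, rfl⟩ := h
  rw [val_injective (Multiset.map_injective (mul_right_injective₀ two_ne_zero) h1)]

theorem exists_toParts_eq {pl : Multiset ℕ × Multiset ℕ} (h1 : pl.1.Nodup)
    (heven : ∀ x ∈ pl.1, Even x) (h2 : pl.2.Nodup) : ∃ p, toParts p = pl := by
  obtain ⟨A, B⟩ := pl
  have hA : (A.map (· / 2)).map (2 * ·) = A := by
    rw [Multiset.map_map]
    conv_rhs => rw [← Multiset.map_id A]
    refine Multiset.map_congr rfl fun x hx => ?_
    have := heven x hx
    simp only [Function.comp, id]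
    exact Nat.two_mul_div_two_of_even this
  refine ⟨(⟨A.map (· / 2), ?_⟩, ⟨B, h2⟩), Prod.ext hA rfl⟩
  rw [← hA] at h1
  exact Multiset.Nodup.of_map _ h1

theorem sum_toParts (p : Pair) : (toParts p).1.sum + (toParts p).2.sum = weight p := by
  rw [toParts, weight, Multiset.sum_map_mul_left, Finset.sum, Finset.sum, Multiset.map_id',
    Multiset.map_id']

theorem card_subtype_eq {P : Multiset ℕ × Multiset ℕ → Prop} {s : Set Pair} {n : ℕ}
    (h : ∀ pl, P pl → ∃ p, toParts p = pl) (hP : ∀ p, P (toParts p) ↔ p ∈ s ∧ weight p = n) :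
    Nat.card {pl // P pl} = {p ∈ s | weight p = n}.ncard := by
  have : {pl | P pl} = toParts '' {p ∈ s | weight p = n} := by
    ext pl
    constructor
    · intro hpl
      obtain ⟨p, rfl⟩ := h pl hpl
      exact ⟨p, (hP p).1 hpl, rfl⟩
    · rintro ⟨p, hp, rfl⟩
      exact (hP p).2 hp
  rw [← Set.ncard_image_of_injective _ toParts_injective, ← this]
  rfl

theorem card_filter_le_eq {S : Finset ℕ} {x : ℕ} (hx : x ∈ S) :
    (((S.val.map (2 * ·)).filter (fun y => y ≤ 2 * x)).card) = #{y ∈ S | y < x} + 1 := by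
  have : {y ∈ S | y ≤ x} = insert x {y ∈ S | y < x} := by
    ext y
    simp only [mem_filter, mem_insert, le_iff_eq_or_lt]
    constructor
    · tauto
    · rintro (rfl | h)
      · exact ⟨hx, Or.inl rfl⟩
      · tauto
  rw [← card_insert_of_notMem (a := x) (by simp), ← this, Multiset.filter_map, Multiset.card_map]
  simp [Finset.card]

end Bipartitions

end RogersSelberg

/-- interpretation of Rogers–Selberg S31: `A(n) = B(n) = C(n)`.
Bipartitions are modelled as pairs of multisets of positive integers whose
total sum is `n`.  For `x` the `j`-th part of the distinct-part partition `π`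
listed in ascending order, `j` is realized as the number of parts of `π`
that are `≤ x`. -/
theorem rogers_selberg_S31_interpretation (n : ℕ) (hn : 0 < n) :
    -- A(n): partitions of n into parts ≡ ±2, ±3 (mod 7)
    (Nat.card {p : Nat.Partition n //
        ∀ x ∈ p.parts, x % 7 = 2 ∨ x % 7 = 3 ∨ x % 7 = 4 ∨ x % 7 = 5} =
      -- B(n)
      Nat.card {pl : Multiset ℕ × Multiset ℕ //
        (∀ x ∈ pl.1, 0 < x) ∧ (∀ x ∈ pl.2, 0 < x) ∧ pl.1.sum + pl.2.sum = n ∧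
        pl.1.Nodup ∧ (∀ x ∈ pl.1, Even x ∧ 2 < x) ∧
        (∀ x ∈ pl.1, ∀ y ∈ pl.1, x < y → x + 4 ≤ y) ∧
        pl.2.Nodup ∧ (∀ x ∈ pl.2, 1 < x) ∧
        ∀ x ∈ pl.1,
          x / 2 ∉ pl.2 ∧ x / 2 + 1 ∉ pl.2 ∧ x / 2 + 2 ∉ pl.2}) ∧
    -- B(n) = C(n)
    (Nat.card {pl : Multiset ℕ × Multiset ℕ //
        (∀ x ∈ pl.1, 0 < x) ∧ (∀ x ∈ pl.2, 0 < x) ∧ pl.1.sum + pl.2.sum = n ∧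
        pl.1.Nodup ∧ (∀ x ∈ pl.1, Even x ∧ 2 < x) ∧
        (∀ x ∈ pl.1, ∀ y ∈ pl.1, x < y → x + 4 ≤ y) ∧
        pl.2.Nodup ∧ (∀ x ∈ pl.2, 1 < x) ∧
        ∀ x ∈ pl.1,
          x / 2 ∉ pl.2 ∧ x / 2 + 1 ∉ pl.2 ∧ x / 2 + 2 ∉ pl.2} =
      Nat.card {pl : Multiset ℕ × Multiset ℕ //
        (∀ x ∈ pl.1, 0 < x) ∧ (∀ x ∈ pl.2, 0 < x) ∧ pl.1.sum + pl.2.sum = n ∧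
        pl.1.Nodup ∧ (∀ x ∈ pl.1, Even x ∧ 2 < x) ∧
        (∀ x ∈ pl.1, ∀ y ∈ pl.1, x < y → x + 4 ≤ y) ∧
        pl.2.Nodup ∧ (∀ x ∈ pl.2, 1 < x) ∧
        ∀ x ∈ pl.1,
          x / 2 + (pl.1.filter (fun y => y ≤ x)).card - 1 ∉ pl.2 ∧
          x / 2 + (pl.1.filter (fun y => y ≤ x)).card ∉ pl.2 ∧
          x / 2 + (pl.1.filter (fun y => y ≤ x)).card + 1 ∉ pl.2}) := by
  obtain ⟨hAB, hBC⟩ := RogersSelberg.ncard_eq n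
  rw [RogersSelberg.card_partition_eq,
    RogersSelberg.card_subtype_eq (s := RogersSelberg.fixedSet 2 2) (n := n),
    RogersSelberg.card_subtype_eq (s := RogersSelberg.shiftedSet 2 2 0) (n := n)]
  · exact ⟨hAB, hBC⟩
  · rintro pl ⟨-, -, -, h1, h2, -, h3, -⟩
    exact RogersSelberg.exists_toParts_eq h1 (fun x hx => (h2 x hx).1) h3
  · rintro p
    rw [RogersSelberg.sum_toParts]
    simp only [RogersSelberg.toParts, Multiset.mem_map, forall_exists_index, and_imp,
      forall_apply_eq_imp_iff₂, Finset.mem_val]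
    constructor
    · rintro ⟨-, -, hw, -, h1, h2, -, h3, h4⟩
      refine ⟨⟨fun x hx => by have := (h1 x hx).2; omega, h3, fun x hx y hy hxy => ?_,
        fun x hx => ?_⟩, hw⟩
      · have := h2 x hx y hy (by omega)
        omega
      · have := h4 x hx
        rwa [Nat.mul_div_cancel_left x two_pos, RogersSelberg.card_filter_le_eq hx,
          ← add_assoc, Nat.add_sub_cancel] at this
    · rintro ⟨⟨h1, h2, h3, h4⟩, hw⟩
      refine ⟨fun x hx => by have := h1 x hx; omega, fun y hy => by have := h2 y hy; omega, hw,
        p.1.nodup.map (mul_right_injective₀ two_ne_zero),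
        fun x hx => ⟨even_two_mul x, by have := h1 x hx; omega⟩, fun x hx y hy hxy => ?_,
        p.2.nodup, fun y hy => h2 y hy, fun x hx => ?_⟩
      · have := h3 x hx y hy (by omega)
        omega
      · have := h4 x hx
        rwa [Nat.mul_div_cancel_left x two_pos, RogersSelberg.card_filter_le_eq hx,
          ← add_assoc, Nat.add_sub_cancel]
  · rintro pl ⟨-, -, -, h1, h2, -, h3, -⟩
    exact RogersSelberg.exists_toParts_eq h1 (fun x hx => (h2 x hx).1) h3
  · rintro p
    rw [RogersSelberg.sum_toParts]
    simp only [RogersSelberg.toParts, Multiset.mem_map, forall_exists_index, and_imp,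
      forall_apply_eq_imp_iff₂, Finset.mem_val]
    constructor
    · rintro ⟨-, -, hw, -, h1, h2, -, h3, h4⟩
      refine ⟨⟨fun x hx => by have := (h1 x hx).2; omega, h3, fun x hx y hy hxy => ?_,
        fun x hx => ?_⟩, hw⟩
      · have := h2 x hx y hy (by omega)
        omega
      · have := h4 x hx
        rwa [Nat.mul_div_cancel_left x two_pos] at this
    · rintro ⟨⟨h1, h2, h3, h4⟩, hw⟩
      refine ⟨fun x hx => by have := h1 x hx; omega, fun y hy => by have := h2 y hy; omega, hw,
        p.1.nodup.map (mul_right_injective₀ two_ne_zero),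
        fun x hx => ⟨even_two_mul x, by have := h1 x hx; omega⟩, fun x hx y hy hxy => ?_,
        p.2.nodup, fun y hy => h2 y hy, fun x hx => ?_⟩
      · have := h3 x hx y hy (by omega)
        omega
      · have := h4 x hx
        rwa [Nat.mul_div_cancel_left x two_pos]
end
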